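/- Let G be a (3k−3)-edge-connected multigraph, where k is a positive integer. If there exists a vertex set Z ⊆ V(G) with |E(G)| ≡ ∑_{v∈Z} d_G(v) (mod k), then G can be edge-decomposed into k spanning subgraphs G_1, …, G_k such that for each vertex v and each i, |d_{G_i}(v) − d_G(v)/k| < 1. -/

import Mathlib

open Finset

variable {V E : Type*}

/-- Degree of `v` in the sub-multigraph given by the edge set `S`,
where `ends e` gives the two endpoints of edge `e` (loops count twice). -/
def mdeg [DecidableEq V] (ends : E → V × V) (S : Finset E) (v : V) : ℕ :=
  (S.filter fun e => (ends e).1 = v).card + (S.filter fun e => (ends e).2 = v).card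

/-- Number of edges with exactly one end in the vertex set `X`. -/
def cutCard [Fintype E] [DecidableEq V] (ends : E → V × V) (X : Finset V) : ℕ :=
  (univ.filter fun e : E =>
    ((ends e).1 ∈ X ∧ (ends e).2 ∉ X) ∨ ((ends e).1 ∉ X ∧ (ends e).2 ∈ X)).card

/-- `lam`-edge-connectedness: every edge cut has at least `lam` edges. -/
def EdgeConn [Fintype V] [Fintype E] [DecidableEq V] (ends : E → V × V) (lam : ℕ) : Prop :=
  ∀ X : Finset V, X.Nonempty → X ≠ univ → lam ≤ cutCard ends X


lemma efz_inv2 {E : Type*} (σ τ : Equiv.Perm E) (hσ : ∀ e, σ (σ e) = e) (hτ : ∀ e, τ (τ e) = e)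
    (fσ : ∀ e, σ e ≠ e) (fτ : ∀ e, τ e ≠ e) :
    ∃ c : E → Bool, ∀ e, c (σ e) = !(c e) ∧ c (τ e) = !(c e) := by
  classical
  set ρ : Equiv.Perm E := σ * τ with hρ
  have hσi : σ⁻¹ = σ := by
    ext e; rw [Equiv.Perm.inv_eq_iff_eq]; exact (hσ e).symm
  have hτi : τ⁻¹ = τ := by
    ext e; rw [Equiv.Perm.inv_eq_iff_eq]; exact (hτ e).symm
  have hconj : ∀ n : ℤ, σ * ρ ^ n = (ρ ^ n)⁻¹ * σ := by
    intro n
    have h1 : σ * ρ * σ⁻¹ = ρ⁻¹ := by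
      rw [hρ, mul_inv_rev, hσi, hτi, ← mul_assoc]
      have : σ * σ = 1 := by ext e; simp [hσ]
      rw [this, one_mul]
    have h2 : σ * ρ ^ n * σ⁻¹ = ρ⁻¹ ^ n := by
      rw [← h1, conj_zpow]
    rw [← inv_zpow, ← h2]; group
  have hconj' : ∀ (n : ℤ) e, σ ((ρ ^ n) e) = ((ρ ^ n)⁻¹) (σ e) := by
    intro n e
    have := congrArg (fun f : Equiv.Perm E => f e) (hconj n)
    simpa using this
  let S := Equiv.Perm.SameCycle.setoid ρ
  let Q := Quotient S
  let m : E → Q := fun e => Quotient.mk S e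
  have hm : ∀ x y, m x = m y ↔ ρ.SameCycle x y := fun x y => Quotient.eq (r := S)
  have hfree : ∀ e, m e ≠ m (σ e) := by
    intro e h
    rw [hm] at h
    obtain ⟨n, hn⟩ := h
    rcases Int.even_or_odd' n with ⟨j, rfl | rfl⟩
    · apply fσ ((ρ ^ j) e)
      rw [hconj', ← hn, two_mul, zpow_add]; simp
    · apply fτ ((ρ ^ j) e)
      have h1 : σ ((ρ ^ j) e) = σ (τ ((ρ ^ j) e)) := by
        rw [hconj', ← hn, show 2 * j + 1 = j + (1 + j) by ring, zpow_add, zpow_add, zpow_one]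
        simp [hρ]
      exact (σ.injective h1).symm
  have hτm : ∀ e, m (τ e) = m (σ e) := by
    intro e
    have : τ e = σ (ρ e) := by simp [hρ, hσ]
    rw [hm, this]
    have := hconj' 1 e
    rw [zpow_one] at this
    rw [this]
    exact ⟨1, by simp⟩
  have hστ : ∀ e, m (σ (τ e)) = m e := by
    intro e; rw [hm]; exact ⟨-1, by simp [hρ]⟩
  let r : Q → Q → Prop := WellOrderingRel
  have key : ∀ a b : Q, a ≠ b → (decide (r b a)) = !(decide (r a b)) := by
    intro a b hab
    rcases trichotomous_of r a b with h | h | h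
    · have : ¬ r b a := asymm_of r h
      simp [h, this]
    · exact absurd h hab
    · have : ¬ r a b := asymm_of r h
      simp [h, this]
  refine ⟨fun e => decide (r (m e) (m (σ e))), fun e => ⟨?_, ?_⟩⟩
  · show decide (r (m (σ e)) (m (σ (σ e)))) = _
    rw [hσ]; exact key _ _ (hfree e)
  · show decide (r (m (τ e)) (m (σ (τ e)))) = _
    rw [hτm, hστ]; exact key _ _ (hfree e)

lemma efz_pairing {E V : Type*} [Finite E] (t : E → V) :
    ∃ σ : Equiv.Perm E, (∀ e, σ (σ e) = e) ∧ (∀ e, t (σ e) = t e) ∧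
      ∀ e e', σ e = e → σ e' = e' → t e = t e' → e = e' := by
  classical
  have := Fintype.ofFinite E
  let T : Finset (Equiv.Perm E) :=
    univ.filter fun σ => (∀ e, σ (σ e) = e) ∧ (∀ e, t (σ e) = t e)
  have hT : T.Nonempty := ⟨1, by simp [T]⟩
  obtain ⟨σ, hσ, hmin⟩ := Finset.exists_min_image T
    (fun σ => (univ.filter fun e => σ e = e).card) hT
  simp only [T, mem_filter, mem_univ, true_and] at hσ hmin
  refine ⟨σ, hσ.1, hσ.2, ?_⟩
  intro e e' he he' ht
  by_contra hne
  have hfix : ∀ x, x ≠ e → x ≠ e' → σ x ≠ e ∧ σ x ≠ e' := by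
    intro x h1 h2
    constructor
    · intro h; apply h1; rw [← hσ.1 x, h, he]
    · intro h; apply h2; rw [← hσ.1 x, h, he']
  have hval : ∀ x, x ≠ e → x ≠ e' → (Equiv.swap e e' * σ) x = σ x := by
    intro x h1 h2
    simp [Equiv.swap_apply_of_ne_of_ne (hfix x h1 h2).1 (hfix x h1 h2).2]
  have hve : (Equiv.swap e e' * σ) e = e' := by simp [he]
  have hve' : (Equiv.swap e e' * σ) e' = e := by simp [he']
  have := hmin (Equiv.swap e e' * σ) ⟨?_, ?_⟩
  · refine absurd this (not_le.mpr (Finset.card_lt_card ?_))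
    rw [Finset.ssubset_iff_of_subset]
    · refine ⟨e, by simp [he], ?_⟩
      simp only [mem_filter, mem_univ, true_and]
      rw [hve]; exact fun h => hne h.symm
    · intro x
      simp only [mem_filter, mem_univ, true_and]
      intro hx
      by_cases h1 : x = e
      · rw [h1, he]
      by_cases h2 : x = e'
      · rw [h2, he']
      rwa [hval x h1 h2] at hx
  · intro x
    by_cases h1 : x = e
    · rw [h1, hve, hve']
    by_cases h2 : x = e'
    · rw [h2, hve', hve]
    rw [hval x h1 h2, hval _ (hfix x h1 h2).1 (hfix x h1 h2).2, hσ.1]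
  · intro x
    by_cases h1 : x = e
    · rw [h1, hve, ht]
    by_cases h2 : x = e'
    · rw [h2, hve', ht]
    rw [hval x h1 h2, hσ.2]

/-- doubling an involution to remove fixed points -/
lemma efz_double {E : Type*} (σ : Equiv.Perm E) (hσ : ∀ e, σ (σ e) = e) :
    ∃ σ' : Equiv.Perm (E × Bool), (∀ x, σ' (σ' x) = x) ∧ (∀ x, σ' x ≠ x) ∧
      ∀ e b, σ e ≠ e → σ' (e, b) = (σ e, b) := by
  classical
  let g : E × Bool → E × Bool := fun x => if σ x.1 = x.1 then (x.1, !x.2) else (σ x.1, x.2)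
  have hg : ∀ x, g (g x) = x := by
    rintro ⟨e, b⟩
    by_cases h : σ e = e
    · simp [g, h]
    · have h' : ¬ e = σ e := fun h' => h h'.symm
      simp [g, h, hσ, h']
  refine ⟨⟨g, g, hg, hg⟩, hg, ?_, ?_⟩
  · rintro ⟨e, b⟩
    by_cases h : σ e = e
    · simp [g, h]
    · simp [g, h]
  · intro e b h
    simp [g, h]

lemma efz_bal_aux {E V : Type*} [Fintype E] [DecidableEq V] (t : E → V) (σ : Equiv.Perm E)
    (hσ : ∀ e, σ (σ e) = e) (ht : ∀ e, t (σ e) = t e)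
    (hu : ∀ e e', σ e = e → σ e' = e' → t e = t e' → e = e') (s : E → ℤ)
    (hs : ∀ e, s e = 1 ∨ s e = -1) (hflip : ∀ e, σ e ≠ e → s (σ e) = - s e) (v : V) :
    |∑ e ∈ univ.filter (fun e => t e = v), s e| ≤ 1 := by
  classical
  rw [← Finset.sum_filter_add_sum_filter_not (univ.filter (fun e => t e = v)) (fun e => σ e = e)]
  have h0 : ∑ e ∈ (univ.filter (fun e => t e = v)).filter (fun e => ¬ σ e = e), s e = 0 := by
    apply Finset.sum_involution (fun e _ => σ e)
    · intro e he
      simp only [mem_filter, mem_univ, true_and] at he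
      rw [hflip e he.2]; ring
    · intro e he _
      simp only [mem_filter, mem_univ, true_and] at he
      exact he.2
    · intro e he
      simp only [mem_filter, mem_univ, true_and] at he ⊢
      refine ⟨by rw [ht, he.1], ?_⟩
      intro h; exact he.2 (σ.injective h)
    · intro e _; exact hσ e
  rw [h0, add_zero]
  set F := (univ.filter (fun e => t e = v)).filter (fun e => σ e = e) with hF
  have hc : F.card ≤ 1 := by
    rw [Finset.card_le_one]
    intro a ha b hb
    simp only [hF, mem_filter, mem_univ, true_and] at ha hb
    exact hu a b ha.2 hb.2 (ha.1.trans hb.1.symm)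
  rcases Nat.le_one_iff_eq_zero_or_eq_one.mp hc with h | h
  · rw [Finset.card_eq_zero] at h; simp [h]
  · obtain ⟨a, ha⟩ := Finset.card_eq_one.mp h
    rw [ha, sum_singleton]
    rcases hs a with h | h <;> simp [h]

lemma efz_bal2 {E V W : Type*} [Fintype E] [DecidableEq V] [DecidableEq W] (t : E → V) (h : E → W) :
    ∃ s : E → ℤ, (∀ e, s e = 1 ∨ s e = -1) ∧
      (∀ v, |∑ e ∈ univ.filter (fun e => t e = v), s e| ≤ 1) ∧
      (∀ v, |∑ e ∈ univ.filter (fun e => h e = v), s e| ≤ 1) := by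
  obtain ⟨σ, h1, h2, h3⟩ := efz_pairing t
  obtain ⟨τ, g1, g2, g3⟩ := efz_pairing h
  obtain ⟨σ', a1, a2, a3⟩ := efz_double σ h1
  obtain ⟨τ', b1, b2, b3⟩ := efz_double τ g1
  obtain ⟨c, hc⟩ := efz_inv2 σ' τ' a1 b1 a2 b2
  let s : E → ℤ := fun e => if c (e, true) then 1 else -1
  have hs : ∀ e, s e = 1 ∨ s e = -1 := by
    intro e; simp only [s]; split_ifs <;> simp
  refine ⟨s, hs, efz_bal_aux t σ h1 h2 h3 s hs ?_, efz_bal_aux h τ g1 g2 g3 s hs ?_⟩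
  · intro e he
    have := (hc (e, true)).1
    rw [a3 e true he] at this
    simp only [s, this]
    cases c (e, true) <;> simp
  · intro e he
    have := (hc (e, true)).2
    rw [b3 e true he] at this
    simp only [s, this]
    cases c (e, true) <;> simp

/-- number of edges in a fiber with a given colour -/
def efzCnt {E V : Type*} [Fintype E] [DecidableEq V] {k : ℕ} (t : E → V) (c : E → Fin k)
    (v : V) (i : Fin k) : ℤ := ∑ e : E, if t e = v ∧ c e = i then 1 else 0

lemma efz_pot {E V : Type*} [Fintype E] [Fintype V] [DecidableEq V] {k : ℕ} (t : E → V)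
    (c c' : E → Fin k) (i j : Fin k) (hij : i ≠ j)
    (hsame : ∀ e, c e ≠ i → c e ≠ j → c' e = c e)
    (hin : ∀ e, c e = i ∨ c e = j → c' e = i ∨ c' e = j)
    (hbal : ∀ v, |efzCnt t c' v i - efzCnt t c' v j| ≤ 1) :
    (∀ v, ∑ l, efzCnt t c' v l ^ 2 ≤ ∑ l, efzCnt t c v l ^ 2) ∧
    (∀ v, efzCnt t c v j + 2 ≤ efzCnt t c v i →
      ∑ l, efzCnt t c' v l ^ 2 < ∑ l, efzCnt t c v l ^ 2) := by
  have hoth : ∀ v l, l ≠ i → l ≠ j → efzCnt t c' v l = efzCnt t c v l := by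
    intro v l hi hj
    apply Finset.sum_congr rfl
    intro e _
    by_cases h1 : c e = i
    · rcases hin e (Or.inl h1) with h | h <;> simp [h1, h, hi.symm, hj.symm]
    by_cases h2 : c e = j
    · rcases hin e (Or.inr h2) with h | h <;> simp [h2, h, hi.symm, hj.symm]
    rw [hsame e h1 h2]
  have hsum : ∀ v, efzCnt t c' v i + efzCnt t c' v j = efzCnt t c v i + efzCnt t c v j := by
    intro v
    simp only [efzCnt, ← Finset.sum_add_distrib]
    apply Finset.sum_congr rfl
    intro e _
    by_cases h1 : c e = i
    · rcases hin e (Or.inl h1) with h | h <;> simp [h1, h, hij, hij.symm]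
    by_cases h2 : c e = j
    · rcases hin e (Or.inr h2) with h | h <;> simp [h2, h, hij, hij.symm]
    rw [hsame e h1 h2]
  have hdiff : ∀ v, ∑ l, efzCnt t c v l ^ 2 - ∑ l, efzCnt t c' v l ^ 2 =
      (efzCnt t c v i ^ 2 - efzCnt t c' v i ^ 2) + (efzCnt t c v j ^ 2 - efzCnt t c' v j ^ 2) := by
    intro v
    rw [← Finset.sum_sub_distrib]
    apply Finset.sum_eq_add i j hij
    · intro l _ hl
      rw [hoth v l hl.1 hl.2]; ring
    · simp
    · simp
  have key : ∀ v, (0:ℤ) ≤ (efzCnt t c v i ^ 2 - efzCnt t c' v i ^ 2) +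
        (efzCnt t c v j ^ 2 - efzCnt t c' v j ^ 2) ∧
      (efzCnt t c v j + 2 ≤ efzCnt t c v i → 0 < (efzCnt t c v i ^ 2 - efzCnt t c' v i ^ 2) +
        (efzCnt t c v j ^ 2 - efzCnt t c' v j ^ 2)) := by
    intro v
    have h1 := hsum v
    have h2 := hbal v
    generalize efzCnt t c v i = x at *
    generalize efzCnt t c v j = y at *
    generalize efzCnt t c' v i = x' at *
    generalize efzCnt t c' v j = y' at *
    have hx : y = x' + y' - x := by linarith
    subst hx
    have h3 : (x ^ 2 - x' ^ 2) + ((x' + y' - x) ^ 2 - y' ^ 2) = 2 * ((x - x') * (x - y')) := by ring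
    rw [h3]
    rw [abs_le] at h2
    constructor
    · by_cases hlt : x' ≤ x ∧ y' ≤ x
      · have := mul_nonneg (sub_nonneg.mpr hlt.1) (sub_nonneg.mpr hlt.2)
        linarith
      · have hle : x ≤ x' ∧ x ≤ y' := by
          by_contra hcon
          omega
        have := mul_nonneg (sub_nonneg.mpr hle.1) (sub_nonneg.mpr hle.2)
        nlinarith
    · intro h4
      have h5 : 0 < x - x' := by omega
      have h6 : 0 < x - y' := by omega
      have := mul_pos h5 h6
      linarith
  refine ⟨fun v => ?_, fun v hv => ?_⟩
  · have := (key v).1; have := hdiff v; linarith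
  · have := (key v).2 hv; have := hdiff v; linarith

lemma efz_equitable {E V : Type*} [Fintype E] [Fintype V] [DecidableEq V] {k : ℕ} (hk : 0 < k)
    (t h : E → V) :
    ∃ c : E → Fin k, (∀ v i j, efzCnt t c v i ≤ efzCnt t c v j + 1) ∧
      (∀ v i j, efzCnt h c v i ≤ efzCnt h c v j + 1) := by
  classical
  have : NeZero k := ⟨hk.ne'⟩
  obtain ⟨c, _, hmin⟩ := Finset.exists_min_image (univ : Finset (E → Fin k))
    (fun c => (∑ v, ∑ l, efzCnt t c v l ^ 2) + ∑ v, ∑ l, efzCnt h c v l ^ 2) ⟨fun _ => 0, by simp⟩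
  -- rebalancing
  have reb : ∀ i j : Fin k, i ≠ j → ∃ c' : E → Fin k,
      (∀ e, c e ≠ i → c e ≠ j → c' e = c e) ∧ (∀ e, c e = i ∨ c e = j → c' e = i ∨ c' e = j) ∧
      (∀ v, |efzCnt t c' v i - efzCnt t c' v j| ≤ 1) ∧
      (∀ v, |efzCnt h c' v i - efzCnt h c' v j| ≤ 1) := by
    intro i j hij
    obtain ⟨s, hs, h1, h2⟩ := efz_bal2 (fun e : {e : E // c e = i ∨ c e = j} => t e.1)
      (fun e : {e : E // c e = i ∨ c e = j} => h e.1)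
    let c' : E → Fin k := fun e =>
      if he : c e = i ∨ c e = j then (if s ⟨e, he⟩ = 1 then i else j) else c e
    have hcnt : ∀ (g : E → V) v, efzCnt g c' v i - efzCnt g c' v j =
        ∑ e ∈ univ.filter (fun e : {e : E // c e = i ∨ c e = j} => g e.1 = v), s e := by
      intro g v
      simp only [efzCnt, ← Finset.sum_sub_distrib]
      rw [Finset.sum_filter]
      have : ∀ e : {e : E // c e = i ∨ c e = j}, (if g e.1 = v then s e else 0) =
          (fun e : E => ((if g e = v ∧ c' e = i then (1:ℤ) else 0) -
            (if g e = v ∧ c' e = j then 1 else 0))) e.1 := by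
        rintro ⟨e, he⟩
        simp only [c', he, dite_true]
        rcases hs ⟨e, he⟩ with h | h
        · by_cases hg : g e = v <;> simp [h, hg, hij]
        · by_cases hg : g e = v <;> simp [h, hg, hij.symm]
      rw [Finset.sum_congr rfl (fun e _ => this e)]
      rw [← Finset.sum_subtype (univ.filter (fun e => c e = i ∨ c e = j)) (fun x => by simp)
        (fun e : E => ((if g e = v ∧ c' e = i then (1:ℤ) else 0) -
            (if g e = v ∧ c' e = j then 1 else 0)))]
      rw [Finset.sum_filter]
      apply Finset.sum_congr rfl
      intro e _
      by_cases he : c e = i ∨ c e = j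
      · rw [if_pos he]
      · rw [if_neg he]
        have hc' : c' e = c e := by simp only [c', he, dite_false]
        have h1 : c e ≠ i := fun h => he (Or.inl h)
        have h2 : c e ≠ j := fun h => he (Or.inr h)
        simp [hc', h1, h2]
    refine ⟨c', ?_, ?_, ?_, ?_⟩
    · intro e h1 h2; simp [c', h1, h2]
    · intro e he; simp only [c', he, dite_true]; split_ifs <;> simp
    · intro v; rw [hcnt]; exact h1 v
    · intro v; rw [hcnt]; exact h2 v
  refine ⟨c, ?_, ?_⟩
  · intro v i j
    by_contra hcon
    have hij : i ≠ j := by rintro rfl; linarith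
    obtain ⟨c', a1, a2, a3, a4⟩ := reb i j hij
    have p1 := efz_pot t c c' i j hij a1 a2 a3
    have p2 := efz_pot h c c' i j hij a1 a2 a4
    have h1 := Finset.sum_lt_sum (fun v (_ : v ∈ univ) => p1.1 v)
      ⟨v, mem_univ v, p1.2 v (by linarith)⟩
    have h2 := Finset.sum_le_sum (fun v (_ : v ∈ univ) => p2.1 v)
    have := hmin c' (mem_univ _)
    linarith
  · intro v i j
    by_contra hcon
    have hij : i ≠ j := by rintro rfl; linarith
    obtain ⟨c', a1, a2, a3, a4⟩ := reb i j hij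
    have p1 := efz_pot t c c' i j hij a1 a2 a3
    have p2 := efz_pot h c c' i j hij a1 a2 a4
    have h1 := Finset.sum_le_sum (fun v (_ : v ∈ univ) => p1.1 v)
    have h2 := Finset.sum_lt_sum (fun v (_ : v ∈ univ) => p2.1 v)
      ⟨v, mem_univ v, p2.2 v (by linarith)⟩
    have := hmin c' (mem_univ _)
    linarith


/-! Part B: modulo orientations -/

/-- distance of `m` to the multiples of `2k` -/
def efzTau (k m : ℤ) : ℤ := min (m % (2 * k)) (2 * k - m % (2 * k))

lemma efzTau_le {k : ℤ} (hk : 0 < k) (m j : ℤ) : efzTau k m ≤ |m - 2 * k * j| := by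
  have h1 := Int.emod_add_mul_ediv m (2 * k)
  have h2 := Int.emod_nonneg m (show 2 * k ≠ 0 by omega)
  have h3 := Int.emod_lt_of_pos m (show 0 < 2 * k by omega)
  unfold efzTau
  set r := m % (2 * k)
  set d := m / (2 * k)
  have h4 : m - 2 * k * j = r + 2 * k * (d - j) := by rw [← h1]; ring
  rw [h4]
  rcases le_or_gt 0 (d - j) with h | h
  · have : 0 ≤ 2 * k * (d - j) := by positivity
    exact (min_le_left _ _).trans (by rw [abs_of_nonneg] <;> linarith)
  · have : 2 * k * (d - j) ≤ 2 * k * (-1) := by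
      apply mul_le_mul_of_nonneg_left <;> omega
    exact (min_le_right _ _).trans (by rw [abs_of_nonpos] <;> linarith)

lemma efzTau_ex {k : ℤ} (hk : 0 < k) (m : ℤ) : ∃ j, efzTau k m = |m - 2 * k * j| := by
  have h1 := Int.emod_add_mul_ediv m (2 * k)
  have h2 := Int.emod_nonneg m (show 2 * k ≠ 0 by omega)
  have h3 := Int.emod_lt_of_pos m (show 0 < 2 * k by omega)
  unfold efzTau
  set r := m % (2 * k)
  set d := m / (2 * k)
  rcases le_total r (2 * k - r) with h | h
  · refine ⟨d, ?_⟩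
    rw [min_eq_left h, ← h1, show r + 2 * k * d - 2 * k * d = r by ring, abs_of_nonneg h2]
  · refine ⟨d + 1, ?_⟩
    rw [min_eq_right h, ← h1, show r + 2 * k * d - 2 * k * (d + 1) = -(2 * k - r) by ring,
      abs_neg, abs_of_nonneg (by linarith)]

lemma efzTau_nonneg {k : ℤ} (hk : 0 < k) (m : ℤ) : 0 ≤ efzTau k m := by
  obtain ⟨j, hj⟩ := efzTau_ex hk m
  rw [hj]; positivity

lemma efzTau_le_k {k : ℤ} (m : ℤ) : efzTau k m ≤ k := by
  unfold efzTau
  omega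

lemma efzTau_add {k : ℤ} (hk : 0 < k) (a b : ℤ) :
    efzTau k (a + b) ≤ efzTau k a + efzTau k b := by
  obtain ⟨i, hi⟩ := efzTau_ex hk a
  obtain ⟨j, hj⟩ := efzTau_ex hk b
  rw [hi, hj]
  refine (efzTau_le hk _ (i + j)).trans ?_
  rw [show a + b - 2 * k * (i + j) = (a - 2 * k * i) + (b - 2 * k * j) by ring]
  exact abs_add_le _ _

lemma efzTau_le_abs {k : ℤ} (hk : 0 < k) (a : ℤ) : efzTau k a ≤ |a| := by
  simpa using efzTau_le hk a 0

lemma efzTau_step {k : ℤ} (hk : 0 < k) (a b : ℤ) :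
    efzTau k b ≤ efzTau k a + |b - a| := by
  have := efzTau_add hk a (b - a)
  rw [show a + (b - a) = b by ring] at this
  linarith [efzTau_le_abs hk (b - a)]

lemma efzTau_congr {k a b : ℤ} (h : 2 * k ∣ b - a) : efzTau k b = efzTau k a := by
  have : b % (2 * k) = a % (2 * k) := (Int.modEq_iff_dvd.mpr h).symm
  unfold efzTau
  rw [this]

lemma efzTau_neg {k : ℤ} (hk : 0 < k) (a : ℤ) : efzTau k (-a) = efzTau k a := by
  have : ∀ a, efzTau k (-a) ≤ efzTau k a := by
    intro a
    obtain ⟨i, hi⟩ := efzTau_ex hk a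
    rw [hi, ← abs_neg]
    refine (efzTau_le hk _ (-i)).trans (le_of_eq ?_)
    congr 1; ring
  refine le_antisymm (this a) ?_
  simpa using this (-a)

lemma efzTau_eq {k : ℤ} (hk : 0 < k) {m j : ℤ} (h : |m - 2 * k * j| ≤ k) :
    efzTau k m = |m - 2 * k * j| := by
  obtain ⟨i, hi⟩ := efzTau_ex hk m
  have h1 := efzTau_le hk m j
  refine le_antisymm h1 ?_
  by_contra hlt
  push Not at hlt
  rw [hi] at hlt
  have hne : i ≠ j := by rintro rfl; exact lt_irrefl _ hlt
  have e : 2 * k * (j - i) = (m - 2 * k * i) - (m - 2 * k * j) := by ring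
  have h2 : |2 * k * (j - i)| < 2 * k := by
    rw [e]
    have := abs_sub (m - 2 * k * i) (m - 2 * k * j)
    linarith
  rw [abs_mul, abs_of_pos (show 0 < 2 * k by omega)] at h2
  have h3 : 1 ≤ |j - i| := Int.one_le_abs (by omega)
  nlinarith

lemma efzTau_parity {k : ℤ} (hk : 0 < k) (m : ℤ) : efzTau k m % 2 = m % 2 := by
  obtain ⟨i, hi⟩ := efzTau_ex hk m
  rw [hi]
  have : m - 2 * k * i = m - 2 * (k * i) := by ring
  rw [this]
  generalize k * i = c
  rcases abs_cases (m - 2 * c) with h | h <;> omega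

lemma efzTau_pos {k : ℤ} (hk : 0 < k) {m : ℤ} (h : ¬ 2 * k ∣ m) : 0 < efzTau k m := by
  obtain ⟨i, hi⟩ := efzTau_ex hk m
  rw [hi, abs_pos]
  intro h0
  exact h ⟨i, by linarith⟩

/-- if adding one increases the distance -/
lemma efzTau_up {k : ℤ} (hk : 0 < k) {m : ℤ} (h : efzTau k m < efzTau k (m + 1)) :
    ∃ j, m = efzTau k m + 2 * k * j := by
  obtain ⟨i, hi⟩ := efzTau_ex hk m
  refine ⟨i, ?_⟩
  have h1 := efzTau_le hk (m + 1) i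
  rcases abs_cases (m - 2 * k * i) with h2 | h2
  · linarith
  · exfalso
    rcases abs_cases (m + 1 - 2 * k * i) with h3 | h3 <;> linarith

lemma efzTau_down {k : ℤ} (hk : 0 < k) {m : ℤ} (h : ¬ 2 * k ∣ m) :
    efzTau k (m - 1) ≤ efzTau k m - 1 ∨ efzTau k (m + 1) ≤ efzTau k m - 1 := by
  obtain ⟨i, hi⟩ := efzTau_ex hk m
  have h0 : m - 2 * k * i ≠ 0 := fun h0 => h ⟨i, by linarith⟩
  have h1 := efzTau_le hk (m + 1) i
  have h1' := efzTau_le hk (m - 1) i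
  rw [show m + 1 - 2 * k * i = (m - 2 * k * i) + 1 by ring] at h1
  rw [show m - 1 - 2 * k * i = (m - 2 * k * i) - 1 by ring] at h1'
  rw [hi]
  generalize m - 2 * k * i = c at *
  rcases lt_or_gt_of_ne h0 with h | h
  · right; rw [abs_of_neg h]; rw [abs_of_nonpos (by omega)] at h1; linarith
  · left; rw [abs_of_pos h]; rw [abs_of_nonneg (by omega)] at h1'; linarith

/-! sums and cuts -/

/-- indicator -/
def efzI {V : Type*} [DecidableEq V] (A : Finset V) (x : V) : ℤ := if x ∈ A then 1 else 0
/-- point mass -/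
def efzC {V : Type*} [DecidableEq V] (x u : V) : ℤ := if u = x then 1 else 0
/-- edge mass -/
def efzD {V : Type*} [DecidableEq V] (x y u v : V) : ℤ :=
  efzC x u * efzC y v + efzC y u * efzC x v

def efzCut {V : Type*} [Fintype V] [DecidableEq V] (w : V → V → ℤ) (A : Finset V) : ℤ :=
  ∑ x ∈ A, ∑ y ∈ Aᶜ, w x y

lemma efzC_sum {V : Type*} [DecidableEq V] (A : Finset V) (x : V) :
    ∑ u ∈ A, efzC x u = efzI A x := by
  simp [efzC, efzI]

lemma efzC_sum_univ {V : Type*} [Fintype V] [DecidableEq V] (x : V) :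
    ∑ u, efzC x u = 1 := by
  simp [efzC]

lemma efzI_compl {V : Type*} [Fintype V] [DecidableEq V] (A : Finset V) (x : V) :
    efzI Aᶜ x = 1 - efzI A x := by
  by_cases h : x ∈ A <;> simp [efzI, h]

lemma efzD_cut {V : Type*} [Fintype V] [DecidableEq V] (A : Finset V) (x y : V) :
    efzCut (efzD x y) A = efzI A x * (1 - efzI A y) + efzI A y * (1 - efzI A x) := by
  unfold efzCut efzD
  simp only [sum_add_distrib, ← mul_sum, ← sum_mul, efzC_sum, efzI_compl]

lemma efzCut_add {V : Type*} [Fintype V] [DecidableEq V] (w w' : V → V → ℤ) (A : Finset V) :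
    efzCut (fun x y => w x y + w' x y) A = efzCut w A + efzCut w' A := by
  simp [efzCut, sum_add_distrib]

lemma efzCut_sub {V : Type*} [Fintype V] [DecidableEq V] (w w' : V → V → ℤ) (A : Finset V) :
    efzCut (fun x y => w x y - w' x y) A = efzCut w A - efzCut w' A := by
  simp [efzCut, sum_sub_distrib]

lemma efzD_sum {V : Type*} [Fintype V] [DecidableEq V] (x y : V) :
    ∑ u, ∑ v, efzD x y u v = 2 := by
  simp only [efzD, sum_add_distrib, ← mul_sum, ← sum_mul, efzC_sum_univ]; norm_num

lemma efzD_symm {V : Type*} [DecidableEq V] (x y u v : V) : efzD x y u v = efzD x y v u := by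
  unfold efzD; ring

lemma efzD_diag {V : Type*} [DecidableEq V] {x y : V} (h : x ≠ y) (u : V) :
    efzD x y u u = 0 := by
  unfold efzD efzC
  split_ifs <;> simp_all

lemma efz_even_sum {V : Type*} [DecidableEq V] (w : V → V → ℤ) (hs : ∀ x y, w x y = w y x)
    (h0 : ∀ x, w x x = 0) (A : Finset V) : Even (∑ x ∈ A, ∑ y ∈ A, w x y) := by
  induction A using Finset.induction_on with
  | empty => simp
  | insert a A ha ih =>
    rw [sum_insert ha]
    simp only [sum_insert ha, sum_add_distrib, h0]
    rw [show ∑ x ∈ A, w x a = ∑ x ∈ A, w a x from sum_congr rfl fun x _ => hs x a]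
    obtain ⟨r, hr⟩ := ih
    exact ⟨∑ x ∈ A, w a x + r, by rw [hr]; ring⟩

/-- orientation goal -/
def EfzOri {V : Type*} [Fintype V] (k : ℤ) (w : V → V → ℤ) (a : V → ℤ) : Prop :=
  ∃ f : V → V → ℤ, (∀ x y, 0 ≤ f x y) ∧ (∀ x y, f x y + f y x = w x y) ∧
    ∀ v, 2 * k ∣ ∑ y, (f v y - f y v) - a v

def efzB {V : Type*} (a p q : V → ℤ) (A : Finset V) : ℤ := ∑ v ∈ A, (a v - p v + q v)
def efzDD {V : Type*} [Fintype V] [DecidableEq V] (w : V → V → ℤ) (p q : V → ℤ)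
    (A : Finset V) : ℤ := efzCut w A + ∑ v ∈ A, (p v + q v)

structure EfzInst {V : Type*} [Fintype V] [DecidableEq V] (k : ℤ) (w : V → V → ℤ)
    (a p q : V → ℤ) (X : Finset V) : Prop where
  wn : ∀ x y, 0 ≤ w x y
  ws : ∀ x y, w x y = w y x
  wd : ∀ x, w x x = 0
  pn : ∀ x, 0 ≤ p x
  qn : ∀ x, 0 ≤ q x
  par : ∀ v, Even (∑ y, w v y + a v)
  sum : 2 * k ∣ ∑ v, a v
  X1 : ∀ x ∈ X, ∀ y ∈ X, x = y
  Xz : ∀ x ∈ X, 2 * k ∣ a x - p x + q x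
  cut : ∀ A : Finset V, A.Nonempty → A ≠ univ → (∀ x ∈ X, A ≠ {x}) →
    2 * k - 2 + efzTau k (efzB a p q A) ≤ efzDD w p q A
  top : ∑ v, (p v + q v) ≤ 2 * k - 2 + efzTau k (efzB a p q univ)

def efzMu {V : Type*} [Fintype V] (k : ℤ) (w : V → V → ℤ) (p q : V → ℤ) : ℤ :=
  Fintype.card V + k * ∑ x, ∑ y, w x y + ∑ v, (p v + q v)

def EfzIH.{u} (k M : ℤ) : Prop :=
  ∀ (V : Type u) [Fintype V] [DecidableEq V] (w : V → V → ℤ) (a p q : V → ℤ) (X : Finset V),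
    EfzInst k w a p q X → efzMu k w p q < M → EfzOri k w a

lemma efz_parity {V : Type*} [Fintype V] [DecidableEq V] {w : V → V → ℤ}
    {a : V → ℤ} (p q : V → ℤ) (ws : ∀ x y, w x y = w y x) (wd : ∀ x, w x x = 0)
    (par : ∀ v, Even (∑ y, w v y + a v)) (A : Finset V) :
    Even (efzDD w p q A + efzB a p q A) := by
  have h1 := efz_even_sum w ws wd A
  have h2 : Even (∑ v ∈ A, (∑ y, w v y + a v)) := by
    apply Finset.sum_induction _ (fun z : ℤ => Even z) (fun _ _ => Even.add) (by simp)
    intro v _; exact par v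
  have h3 : ∑ v ∈ A, ∑ y, w v y = efzCut w A + ∑ x ∈ A, ∑ y ∈ A, w x y := by
    unfold efzCut
    rw [← sum_add_distrib]
    apply sum_congr rfl
    intro x _
    rw [add_comm, Finset.sum_add_sum_compl]
  rw [sum_add_distrib, h3] at h2
  unfold efzDD efzB
  simp only [sum_add_distrib, sum_sub_distrib]
  obtain ⟨r, hr⟩ := h1
  obtain ⟨s, hs⟩ := h2
  refine ⟨s - r + ∑ v ∈ A, q v, ?_⟩
  rw [hr] at hs
  linarith

lemma EfzInst.parity {V : Type*} [Fintype V] [DecidableEq V] {k : ℤ} {w : V → V → ℤ}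
    {a p q : V → ℤ} {X : Finset V} (h : EfzInst k w a p q X) (A : Finset V) :
    Even (efzDD w p q A + efzB a p q A) :=
  efz_parity p q h.ws h.wd h.par A

lemma efzB_single {V : Type*} (a p q : V → ℤ) (v : V) :
    efzB a p q {v} = a v - p v + q v := by simp [efzB]

lemma efzB_compl {V : Type*} [Fintype V] [DecidableEq V] (a p q : V → ℤ) (A : Finset V) :
    efzB a p q A + efzB a p q Aᶜ = efzB a p q univ := by
  unfold efzB
  rw [Finset.sum_add_sum_compl]

lemma efzDD_single {V : Type*} [Fintype V] [DecidableEq V] {w : V → V → ℤ}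
    (h0 : ∀ x, w x x = 0) (p q : V → ℤ) (v : V) :
    efzDD w p q {v} = ∑ y, w v y + (p v + q v) := by
  unfold efzDD efzCut
  have := Finset.sum_add_sum_compl {v} (fun y => w v y)
  simp only [sum_singleton, h0, zero_add] at this ⊢
  rw [this]


lemma efz_del {V : Type*} [Fintype V] [DecidableEq V] {k : ℤ} {w : V → V → ℤ} {a : V → ℤ}
    (x y : V)
    (h : EfzOri k (fun u v => w u v - efzD x y u v) (fun v => a v - efzC x v + efzC y v)) :
    EfzOri k w a := by
  obtain ⟨f, f0, f1, f2⟩ := h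
  refine ⟨fun u v => f u v + efzC x u * efzC y v, ?_, ?_, ?_⟩
  · intro u v
    have := f0 u v
    have : 0 ≤ efzC x u * efzC y v := by unfold efzC; split_ifs <;> simp
    linarith
  · intro u v
    have := f1 u v
    unfold efzD at this
    linarith
  · intro v
    have e : ∑ z, (f v z + efzC x v * efzC y z - (f z v + efzC x z * efzC y v)) - a v =
        ∑ z, (f v z - f z v) - (a v - efzC x v + efzC y v) := by
      simp only [sum_sub_distrib, sum_add_distrib, ← mul_sum, ← sum_mul, efzC_sum_univ]
      ring
    rw [e]
    exact f2 v

lemma efz_lift {V : Type*} [Fintype V] [DecidableEq V] {k : ℤ} {w : V → V → ℤ} {a : V → ℤ}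
    {x u v : V} (huv : u ≠ v) (hw : 0 ≤ w u v) (hux : u ≠ x) (hvx : v ≠ x)
    (h : EfzOri k (fun s t => w s t - efzD x u s t - efzD x v s t + efzD u v s t) a) :
    EfzOri k w a := by
  obtain ⟨f, f0, f1, f2⟩ := h
  have key : ∀ u v, u ≠ v → 1 ≤ f u v →
      (∀ s t, f s t + f t s = w s t - efzD x u s t - efzD x v s t + efzD u v s t) →
      EfzOri k w a := by
    intro u v huv h1 f1
    refine ⟨fun s t => f s t - efzC u s * efzC v t + efzC u s * efzC x t + efzC x s * efzC v t,
      ?_, ?_, ?_⟩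
    · intro s t
      have h0 := f0 s t
      have e1 : 0 ≤ efzC u s * efzC x t := by unfold efzC; split_ifs <;> simp
      have e2 : 0 ≤ efzC x s * efzC v t := by unfold efzC; split_ifs <;> simp
      have e3 : efzC u s * efzC v t ≤ f s t := by
        unfold efzC
        split_ifs with a1 a2
        · subst a1; subst a2; simpa using h1
        all_goals simpa using h0
      linarith
    · intro s t
      have := f1 s t
      unfold efzD at this
      linarith
    · intro z
      have e : ∑ y, ((f z y - efzC u z * efzC v y + efzC u z * efzC x y + efzC x z * efzC v y) -
          (f y z - efzC u y * efzC v z + efzC u y * efzC x z + efzC x y * efzC v z)) - a z =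
          ∑ y, (f z y - f y z) - a z := by
        simp only [sum_sub_distrib, sum_add_distrib, ← mul_sum, ← sum_mul, efzC_sum_univ]
        ring
      rw [e]
      exact f2 z
  have h2 : f u v + f v u = w u v - efzD x u u v - efzD x v u v + efzD u v u v := f1 u v
  have e : w u v - efzD x u u v - efzD x v u v + efzD u v u v = w u v + 1 := by
    simp [efzD, efzC, huv, huv.symm, hux, hvx, hux.symm, hvx.symm]
  rw [e] at h2
  by_cases h3 : 1 ≤ f u v
  · exact key u v huv h3 f1
  · refine key v u huv.symm (by omega) ?_
    intro s t
    rw [f1 s t]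
    unfold efzD; ring

lemma efz_rev_ori {V : Type*} [Fintype V] {k : ℤ} {w : V → V → ℤ} {a : V → ℤ}
    (h : EfzOri k w (fun v => - a v)) : EfzOri k w a := by
  obtain ⟨f, f0, f1, f2⟩ := h
  refine ⟨fun x y => f y x, fun x y => f0 y x, fun x y => by rw [← f1 x y]; ring, fun v => ?_⟩
  obtain ⟨c, hc⟩ := f2 v
  refine ⟨-c, ?_⟩
  simp only [sum_sub_distrib] at hc ⊢
  linarith

lemma efzB_rev {V : Type*} (a p q : V → ℤ) (A : Finset V) :
    efzB (fun v => - a v) q p A = - efzB a p q A := by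
  unfold efzB; rw [← sum_neg_distrib]; apply sum_congr rfl; intros; ring

lemma efzDD_rev {V : Type*} [Fintype V] [DecidableEq V] (w : V → V → ℤ) (p q : V → ℤ)
    (A : Finset V) : efzDD w q p A = efzDD w p q A := by
  unfold efzDD; congr 1; apply sum_congr rfl; intros; ring

lemma EfzInst.rev {V : Type*} [Fintype V] [DecidableEq V] {k : ℤ} (hk : 0 < k) {w : V → V → ℤ}
    {a p q : V → ℤ} {X : Finset V} (h : EfzInst k w a p q X) :
    EfzInst k w (fun v => - a v) q p X where
  wn := h.wn
  ws := h.ws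
  wd := h.wd
  pn := h.qn
  qn := h.pn
  par := fun v => by
    obtain ⟨r, hr⟩ := h.par v
    exact ⟨r - a v, by linarith⟩
  sum := by rw [sum_neg_distrib]; exact dvd_neg.mpr h.sum
  X1 := h.X1
  Xz := fun x hx => by
    obtain ⟨c, hc⟩ := h.Xz x hx
    exact ⟨-c, by linarith⟩
  cut := fun A h1 h2 h3 => by
    rw [efzB_rev, efzTau_neg hk, efzDD_rev]; exact h.cut A h1 h2 h3
  top := by
    rw [efzB_rev, efzTau_neg hk]
    refine le_trans (le_of_eq ?_) h.top
    apply sum_congr rfl; intros; ring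

lemma efzMu_rev {V : Type*} [Fintype V] (k : ℤ) (w : V → V → ℤ) (p q : V → ℤ) :
    efzMu k w q p = efzMu k w p q := by
  unfold efzMu; congr 1; apply sum_congr rfl; intros; ring

/-- distributing an amount below a capacity -/
lemma efz_distr {V : Type*} (A : Finset V) (w : V → ℤ) (hw : ∀ v, 0 ≤ w v) :
    ∀ m, 0 ≤ m → m ≤ ∑ v ∈ A, w v →
    ∃ g : V → ℤ, (∀ v, 0 ≤ g v) ∧ (∀ v, g v ≤ w v) ∧ ∑ v ∈ A, g v = m := by
  classical
  induction A using Finset.induction_on with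
  | empty =>
    intro m h0 h1
    refine ⟨fun _ => 0, by simp, hw, ?_⟩
    simp at h1 ⊢; omega
  | insert a A ha ih =>
    intro m h0 h1
    rw [sum_insert ha] at h1
    obtain ⟨g, g0, g1, g2⟩ := ih (max 0 (m - w a)) (le_max_left _ _) (by
      apply max_le
      · exact sum_nonneg fun v _ => hw v
      · linarith)
    refine ⟨fun v => if v = a then min m (w a) else g v, ?_, ?_, ?_⟩
    · intro v; dsimp only; split_ifs with h
      · exact le_min h0 (hw a)
      · exact g0 v
    · intro v; dsimp only; split_ifs with h
      · subst h; exact min_le_right _ _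
      · exact g1 v
    · rw [sum_insert ha]
      have : ∑ x ∈ A, (if x = a then min m (w a) else g x) = ∑ x ∈ A, g x := by
        apply sum_congr rfl
        intro x hx
        rw [if_neg]; rintro rfl; exact ha hx
      rw [this, g2]
      simp
      omega

/-! quotients -/

def efzQw {V W : Type*} [Fintype V] [DecidableEq W] (π : V → W) (w : V → V → ℤ) (i j : W) : ℤ :=
  if i = j then 0 else ∑ x ∈ univ.filter (fun x => π x = i), ∑ y ∈ univ.filter (fun y => π y = j), w x y

def efzQa {V W : Type*} [Fintype V] [DecidableEq W] (π : V → W) (a : V → ℤ) (i : W) : ℤ :=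
  ∑ x ∈ univ.filter (fun x => π x = i), a x

lemma efzQa_sum {V W : Type*} [Fintype V] [DecidableEq W] (π : V → W) (a : V → ℤ)
    (B : Finset W) : ∑ i ∈ B, efzQa π a i = ∑ x ∈ univ.filter (fun x => π x ∈ B), a x := by
  unfold efzQa
  rw [← Finset.sum_fiberwise_of_maps_to (s := univ.filter (fun x => π x ∈ B)) (t := B) (g := π)
    (by simp)]
  apply sum_congr rfl
  intro i hi
  apply sum_congr _ (fun _ _ => rfl)
  ext x
  simp only [mem_filter, mem_univ, true_and]
  constructor
  · rintro rfl; exact ⟨hi, rfl⟩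
  · exact fun h => h.2

lemma efzQw_cut {V W : Type*} [Fintype V] [DecidableEq V] [Fintype W] [DecidableEq W] (π : V → W)
    (w : V → V → ℤ) (B : Finset W) :
    efzCut (efzQw π w) B = efzCut w (univ.filter (fun x => π x ∈ B)) := by
  unfold efzCut
  have h1 : ∀ i ∈ B, ∑ j ∈ Bᶜ, efzQw π w i j =
      efzQa π (fun x => ∑ y ∈ (univ.filter (fun x => π x ∈ B))ᶜ, w x y) i := by
    intro i hi
    unfold efzQa
    rw [show (univ.filter (fun x => π x ∈ B))ᶜ = univ.filter (fun x => π x ∈ Bᶜ) by ext; simp]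
    rw [sum_congr rfl (fun x _ => (efzQa_sum π (fun y => w x y) Bᶜ).symm), sum_comm]
    apply sum_congr rfl
    intro j hj
    rw [efzQw, if_neg]
    · rfl
    · rintro rfl; exact (mem_compl.mp hj) hi
  rw [sum_congr rfl h1, efzQa_sum]

lemma efzQw_row {V W : Type*} [Fintype V] [Fintype W] [DecidableEq W] (π : V → W)
    (w : V → V → ℤ) (i : W) :
    ∑ j, efzQw π w i j = efzQa π (fun x => ∑ y, w x y) i -
      ∑ x ∈ univ.filter (fun x => π x = i), ∑ y ∈ univ.filter (fun x => π x = i), w x y := by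
  have h : ∀ j, efzQw π w i j = efzQa π (fun x => efzQa π (fun y => w x y) j) i -
      if i = j then ∑ x ∈ univ.filter (fun x => π x = i),
        ∑ y ∈ univ.filter (fun x => π x = i), w x y else 0 := by
    intro j
    unfold efzQw efzQa
    split_ifs with h
    · subst h; simp
    · simp
  rw [sum_congr rfl (fun j _ => h j), sum_sub_distrib]
  simp only [sum_ite_eq, mem_univ, if_true]
  congr 1
  unfold efzQa
  rw [sum_comm]
  apply sum_congr rfl
  intro x _
  exact Finset.sum_fiberwise univ π (fun y => w x y)

lemma efzQ_B {V W : Type*} [Fintype V] [DecidableEq W] (π : V → W) (a p q : V → ℤ)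
    (B : Finset W) : efzB (efzQa π a) (efzQa π p) (efzQa π q) B =
      efzB a p q (univ.filter (fun x => π x ∈ B)) := by
  unfold efzB
  simp only [sum_add_distrib, sum_sub_distrib, efzQa_sum]

lemma EfzInst.quot {V W : Type*} [Fintype V] [DecidableEq V] [Fintype W] [DecidableEq W]
    (π : V → W) (hπ : Function.Surjective π) {k : ℤ} {w : V → V → ℤ}
    {a p q : V → ℤ} {X : Finset V} (h : EfzInst k w a p q X) :
    EfzInst k (efzQw π w) (efzQa π a) (efzQa π p) (efzQa π q)
      (univ.filter (fun i => ∃ x ∈ X, ∀ y, π y = i ↔ y = x)) where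
  wn := fun x y => by
    unfold efzQw; split_ifs
    · exact le_rfl
    · exact sum_nonneg fun _ _ => sum_nonneg fun _ _ => h.wn _ _
  ws := fun x y => by
    unfold efzQw
    by_cases e : x = y
    · subst e; simp
    · rw [if_neg e, if_neg (Ne.symm e), sum_comm]
      exact sum_congr rfl fun _ _ => sum_congr rfl fun _ _ => h.ws _ _
  wd := fun x => by simp [efzQw]
  pn := fun x => sum_nonneg fun _ _ => h.pn _
  qn := fun x => sum_nonneg fun _ _ => h.qn _
  par := fun i => by
    rw [efzQw_row]
    have h1 := efz_even_sum w h.ws h.wd (univ.filter (fun x => π x = i))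
    have h2 : Even (∑ v ∈ univ.filter (fun x => π x = i), (∑ y, w v y + a v)) := by
      apply Finset.sum_induction _ (fun z : ℤ => Even z) (fun _ _ => Even.add) (by simp)
      intro v _; exact h.par v
    rw [sum_add_distrib] at h2
    unfold efzQa
    obtain ⟨r, hr⟩ := h1
    obtain ⟨t, ht⟩ := h2
    exact ⟨t - r, by linarith⟩
  sum := by
    rw [efzQa_sum]; simpa using h.sum
  X1 := by
    intro i hi j hj
    simp only [mem_filter, mem_univ, true_and] at hi hj
    obtain ⟨x, hx, hx'⟩ := hi
    obtain ⟨y, hy, hy'⟩ := hj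
    have := h.X1 x hx y hy
    subst this
    rw [← (hx' x).mpr rfl, ← (hy' x).mpr rfl]
  Xz := by
    intro i hi
    simp only [mem_filter, mem_univ, true_and] at hi
    obtain ⟨x, hx, hx'⟩ := hi
    unfold efzQa
    have : univ.filter (fun y => π y = i) = {x} := by ext y; simp [hx']
    rw [this]
    simpa using h.Xz x hx
  cut := by
    intro B h1 h2 h3
    rw [efzQ_B]
    unfold efzDD
    rw [efzQw_cut, sum_add_distrib, efzQa_sum, efzQa_sum, ← sum_add_distrib]
    apply h.cut
    · obtain ⟨i, hi⟩ := h1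
      obtain ⟨x, rfl⟩ := hπ i
      exact ⟨x, by simpa using hi⟩
    · intro e
      apply h2
      rw [eq_univ_iff_forall] at e ⊢
      intro i
      obtain ⟨x, rfl⟩ := hπ i
      simpa using e x
    · intro x hx e
      have hx1 : ∀ y, π y ∈ B ↔ y = x := by
        intro y
        have := Finset.ext_iff.mp e y
        simpa using this
      have hB : B = {π x} := by
        ext i
        obtain ⟨y, rfl⟩ := hπ i
        rw [hx1, mem_singleton]
        constructor
        · rintro rfl; rfl
        · intro e2; rw [← hx1, e2, hx1]
      refine h3 (π x) ?_ hB
      simp only [mem_filter, mem_univ, true_and]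
      refine ⟨x, hx, fun y => ?_⟩
      rw [← hx1, hB, mem_singleton]
  top := by
    rw [efzQ_B, sum_add_distrib, efzQa_sum, efzQa_sum, ← sum_add_distrib]
    simpa using h.top

lemma efzMu_quot {V W : Type*} [Fintype V] [DecidableEq V] [Fintype W] [DecidableEq W]
    (π : V → W) {k : ℤ} (hk : 0 < k) {w : V → V → ℤ}
    {a p q : V → ℤ} {X : Finset V} (h : EfzInst k w a p q X)
    (hc : Fintype.card W < Fintype.card V) :
    efzMu k (efzQw π w) (efzQa π p) (efzQa π q) < efzMu k w p q := by
  unfold efzMu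
  have h1 : ∑ v, (efzQa π p v + efzQa π q v) = ∑ v, (p v + q v) := by
    rw [sum_add_distrib, efzQa_sum, efzQa_sum, ← sum_add_distrib]; simp
  have h2 : ∑ x, ∑ y, efzQw π w x y ≤ ∑ x, ∑ y, w x y := by
    rw [sum_congr rfl (fun i _ => efzQw_row π w i), sum_sub_distrib, efzQa_sum]
    simp only [mem_univ, filter_true]
    have : 0 ≤ ∑ i, ∑ x ∈ univ.filter (fun x => π x = i),
        ∑ y ∈ univ.filter (fun x => π x = i), w x y :=
      sum_nonneg fun _ _ => sum_nonneg fun _ _ => sum_nonneg fun _ _ => h.wn _ _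
    linarith
  have h3 := mul_le_mul_of_nonneg_left h2 hk.le
  rw [h1]
  have : (Fintype.card W : ℤ) < Fintype.card V := by exact_mod_cast hc
  linarith


def efzPi {V : Type*} [DecidableEq V] (A : Finset V) (v : V) : Option {v : V // v ∉ A} :=
  if h : v ∈ A then none else some ⟨v, h⟩

lemma efzPi_mem {V : Type*} [DecidableEq V] {A : Finset V} {v : V} (h : v ∈ A) :
    efzPi A v = none := by simp [efzPi, h]

lemma efzPi_not_mem {V : Type*} [DecidableEq V] {A : Finset V} {v : V} (h : v ∉ A) :
    efzPi A v = some ⟨v, h⟩ := by simp [efzPi, h]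

lemma efzPi_surj {V : Type*} [DecidableEq V] {A : Finset V} (h : A.Nonempty) :
    Function.Surjective (efzPi A) := by
  intro i
  cases i with
  | none => obtain ⟨v, hv⟩ := h; exact ⟨v, efzPi_mem hv⟩
  | some y => exact ⟨y.1, efzPi_not_mem y.2⟩

lemma efzPi_fib_none {V : Type*} [Fintype V] [DecidableEq V] (A : Finset V) :
    univ.filter (fun v => efzPi A v = none) = A := by
  ext v
  by_cases h : v ∈ A <;> simp [efzPi, h]

lemma efzPi_fib_some {V : Type*} [Fintype V] [DecidableEq V] {A : Finset V} {y : V}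
    (hy : y ∉ A) : univ.filter (fun v => efzPi A v = efzPi A y) = {y} := by
  ext v
  rw [efzPi_not_mem hy]
  by_cases h : v ∈ A
  · simp [efzPi, h]; rintro rfl; exact hy h
  · simp [efzPi, h]

lemma efzPi_sum {V : Type*} [Fintype V] [DecidableEq V] (A : Finset V)
    (G : Option {v : V // v ∉ A} → ℤ) :
    ∑ i, G i = G none + ∑ y ∈ Aᶜ, G (efzPi A y) := by
  rw [Fintype.sum_option, Finset.sum_subtype Aᶜ (p := fun v => v ∉ A) (by simp)]
  congr 1
  apply sum_congr rfl
  intro y _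
  rw [efzPi_not_mem y.2]

lemma efzPi_card {V : Type*} [Fintype V] [DecidableEq V] (A : Finset V) (hA : 2 ≤ A.card) :
    Fintype.card (Option {v : V // v ∉ A}) < Fintype.card V := by
  rw [Fintype.card_option, Fintype.card_subtype]
  have : (univ.filter (fun v => v ∉ A)) = Aᶜ := by ext; simp
  rw [this, card_compl]
  have := card_le_univ A
  omega

lemma efz_combine {V : Type*} [Fintype V] [DecidableEq V] {k : ℤ} {w : V → V → ℤ} {a : V → ℤ}
    (A : Finset V) (wn : ∀ x y, 0 ≤ w x y) (ws : ∀ x y, w x y = w y x)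
    (wd : ∀ x, w x x = 0)
    (hq : EfzOri k (efzQw (efzPi A) w) (efzQa (efzPi A) a))
    (hin : ∀ g : V → V → ℤ, (∀ y v, 0 ≤ g y v) → (∀ y v, g y v ≤ w y v) →
      2 * k ∣ ∑ v ∈ A, (a v - ∑ y ∈ Aᶜ, (w v y - 2 * g y v)) →
      EfzOri k (fun x y : {v : V // v ∈ A} => w x y)
        (fun v : {v : V // v ∈ A} => a v - ∑ y ∈ Aᶜ, (w v y - 2 * g y v))) :
    EfzOri k w a := by
  obtain ⟨f, f0, f1, f2⟩ := hq
  have hsn : ∀ y, y ∉ A → efzQw (efzPi A) w (efzPi A y) none = ∑ v ∈ A, w y v := by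
    intro y hy
    rw [efzQw, if_neg (by rw [efzPi_not_mem hy]; simp), efzPi_fib_some hy, efzPi_fib_none]
    simp
  have hss : ∀ y z, y ∉ A → z ∉ A → efzQw (efzPi A) w (efzPi A y) (efzPi A z) = w y z := by
    intro y z hy hz
    unfold efzQw
    by_cases h : y = z
    · subst h; simp [wd]
    · rw [if_neg (by rw [efzPi_not_mem hy, efzPi_not_mem hz]; simpa using h),
        efzPi_fib_some hy, efzPi_fib_some hz]
      simp
  have hg : ∀ y, ∃ g : V → ℤ, (∀ v, 0 ≤ g v) ∧ (∀ v, g v ≤ w y v) ∧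
      (y ∉ A → ∑ v ∈ A, g v = f (efzPi A y) none) := by
    intro y
    by_cases hy : y ∈ A
    · exact ⟨fun _ => 0, by simp, fun v => wn y v, fun h => absurd hy h⟩
    · obtain ⟨g, g0, g1, g2⟩ := efz_distr A (w y) (wn y) (f (efzPi A y) none) (f0 _ _) (by
        have := f1 (efzPi A y) none
        rw [hsn y hy] at this
        have := f0 none (efzPi A y)
        linarith)
      exact ⟨g, g0, g1, fun _ => g2⟩
  choose g g0 g1 g2 using hg
  have hfn : ∀ y, y ∉ A → f none (efzPi A y) = ∑ v ∈ A, (w y v - g y v) := by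
    intro y hy
    have := f1 (efzPi A y) none
    rw [hsn y hy, ← g2 y hy] at this
    rw [sum_sub_distrib]; linarith
  obtain ⟨h, h0, h1, h2⟩ := hin g g0 g1 (by
    have := f2 none
    rw [efzPi_sum, sub_self, zero_add, efzQa, efzPi_fib_none] at this
    rw [sum_sub_distrib, sum_comm]
    rw [sum_congr rfl (fun y hy => by rw [hfn y (mem_compl.mp hy), ← g2 y (mem_compl.mp hy),
      ← sum_sub_distrib])] at this
    obtain ⟨c, hc⟩ := this
    refine ⟨-c, ?_⟩
    have e : ∑ y ∈ Aᶜ, ∑ x ∈ A, (w x y - 2 * g y x) =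
        ∑ x ∈ Aᶜ, ∑ x_1 ∈ A, (w x x_1 - g x x_1 - g x x_1) :=
      sum_congr rfl fun y _ => sum_congr rfl fun x _ => by rw [ws x y]; ring
    rw [e]
    linarith)
  refine ⟨fun x y => if hx : x ∈ A then (if hy : y ∈ A then h ⟨x, hx⟩ ⟨y, hy⟩ else w x y - g y x)
    else (if y ∈ A then g x y else f (efzPi A x) (efzPi A y)), ?_, ?_, ?_⟩
  · intro x y
    by_cases hx : x ∈ A <;> by_cases hy : y ∈ A <;> simp only [hx, hy, dite_true, dite_false,
      if_true, if_false]
    · exact h0 _ _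
    · have := g1 y x; rw [ws y x] at this; linarith
    · exact g0 _ _
    · exact f0 _ _
  · intro x y
    by_cases hx : x ∈ A <;> by_cases hy : y ∈ A <;> simp only [hx, hy, dite_true, dite_false,
      if_true, if_false]
    · exact h1 _ _
    · ring
    · rw [ws y x]; ring
    · rw [f1, hss x y hx hy]
  · intro v
    rw [← Finset.sum_add_sum_compl A]
    by_cases hv : v ∈ A
    · simp only [hv, dite_true, if_true]
      have e1 : ∑ i ∈ A, ((if hy : i ∈ A then h ⟨v, hv⟩ ⟨i, hy⟩ else w v i - g i v) -
          if hx : i ∈ A then h ⟨i, hx⟩ ⟨v, hv⟩ else g i v) =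
          ∑ i : {v : V // v ∈ A}, (h ⟨v, hv⟩ i - h i ⟨v, hv⟩) := by
        rw [Finset.sum_subtype A (p := fun v => v ∈ A) (fun x => Iff.rfl)]
        apply sum_congr rfl
        rintro ⟨i, hi⟩ _
        simp [hi]
      have e2 : ∑ i ∈ Aᶜ, ((if hy : i ∈ A then h ⟨v, hv⟩ ⟨i, hy⟩ else w v i - g i v) -
          if hx : i ∈ A then h ⟨i, hx⟩ ⟨v, hv⟩ else g i v) =
          ∑ i ∈ Aᶜ, (w v i - 2 * g i v) := by
        apply sum_congr rfl
        intro i hi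
        simp only [mem_compl.mp hi, dite_false]; ring
      rw [e1, e2]
      obtain ⟨c, hc⟩ := h2 ⟨v, hv⟩
      exact ⟨c, by rw [← hc]; ring⟩
    · simp only [hv, dite_false, if_false]
      have e1 : ∑ x ∈ A, ((if x ∈ A then g v x else f (efzPi A v) (efzPi A x)) -
          if hx : x ∈ A then w x v - g v x else f (efzPi A x) (efzPi A v)) =
          f (efzPi A v) none - f none (efzPi A v) := by
        rw [hfn v hv, ← g2 v hv, ← sum_sub_distrib]
        apply sum_congr rfl
        intro x hx
        simp only [hx, if_true, dite_true]
        rw [ws x v]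
      have e2 : ∑ x ∈ Aᶜ, ((if x ∈ A then g v x else f (efzPi A v) (efzPi A x)) -
          if hx : x ∈ A then w x v - g v x else f (efzPi A x) (efzPi A v)) =
          ∑ x ∈ Aᶜ, (f (efzPi A v) (efzPi A x) - f (efzPi A x) (efzPi A v)) := by
        apply sum_congr rfl
        intro x hx
        simp only [mem_compl.mp hx, if_false, dite_false]
      have := f2 (efzPi A v)
      rw [efzPi_sum, efzQa, efzPi_fib_some hv, sum_singleton] at this
      rw [e1, e2]
      exact this

lemma efz_quot_ori.{u} {V : Type u} [Fintype V] [DecidableEq V] {k : ℤ} (hk : 0 < k)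
    {w : V → V → ℤ} {a p q : V → ℤ} {X : Finset V} (h : EfzInst k w a p q X)
    (ih : EfzIH.{u} k (efzMu k w p q)) (A : Finset V) (hA : 2 ≤ A.card) :
    EfzOri k (efzQw (efzPi A) w) (efzQa (efzPi A) a) := by
  have hne : A.Nonempty := card_pos.mp (by omega)
  exact ih _ _ _ _ _ _ (h.quot (efzPi A) (efzPi_surj hne))
    (efzMu_quot (efzPi A) hk h (efzPi_card A hA))

lemma efz_subsum {V : Type*} {A : Finset V} (B : Finset {v : V // v ∈ A})
    (F : V → ℤ) : ∑ v ∈ B, F v.1 = ∑ v ∈ B.map (Function.Embedding.subtype _), F v := by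
  rw [sum_map]; rfl

lemma efz_subcut {V : Type*} [Fintype V] [DecidableEq V] {A : Finset V}
    (B : Finset {v : V // v ∈ A}) (w : V → V → ℤ) :
    efzCut (fun x y : {v : V // v ∈ A} => w x y) B + ∑ v ∈ B, ∑ y ∈ Aᶜ, w v y
      = efzCut w (B.map (Function.Embedding.subtype _)) := by
  unfold efzCut
  rw [← efz_subsum B (fun v => ∑ y ∈ (B.map (Function.Embedding.subtype _))ᶜ, w v y),
    ← sum_add_distrib]
  apply sum_congr rfl
  intro v _
  rw [efz_subsum Bᶜ (fun y => w v y), ← sum_union]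
  · apply sum_congr _ (fun _ _ => rfl)
    ext y
    by_cases hy : y ∈ A <;> simp [hy]
  · rw [disjoint_left]
    intro y hy
    simp at hy ⊢
    exact hy.1

lemma efz_step1.{u} {V : Type u} [Fintype V] [DecidableEq V] {k : ℤ} (hk : 0 < k)
    {w : V → V → ℤ} {a p q : V → ℤ} {X : Finset V} (h : EfzInst k w a p q X)
    (ih : EfzIH.{u} k (efzMu k w p q)) (A : Finset V) (hA : 2 ≤ A.card) (hA' : A ≠ univ)
    (ht : efzDD w p q A ≤ 2 * k - 2 + efzTau k (efzB a p q A)) : EfzOri k w a := by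
  apply efz_combine A h.wn h.ws h.wd (efz_quot_ori hk h ih A hA)
  intro g g0 g1 gs
  have hB : ∀ B : Finset {v : V // v ∈ A},
      efzB (fun v : {v : V // v ∈ A} => a v - ∑ y ∈ Aᶜ, (w v y - 2 * g y v))
      (fun v => p v + ∑ y ∈ Aᶜ, g y v) (fun v => q v + ∑ y ∈ Aᶜ, (w v y - g y v)) B =
      efzB a p q (B.map (Function.Embedding.subtype _)) := by
    intro B
    unfold efzB
    rw [← efz_subsum B (fun v => a v - p v + q v)]
    apply sum_congr rfl
    intro v _
    simp only [sum_sub_distrib, ← mul_sum]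
    ring
  have hs : ∀ B : Finset {v : V // v ∈ A},
      ∑ v ∈ B, ((p v + ∑ y ∈ Aᶜ, g y v) + (q v + ∑ y ∈ Aᶜ, (w v y - g y v))) =
      ∑ v ∈ B.map (Function.Embedding.subtype _), (p v + q v) + ∑ v ∈ B, ∑ y ∈ Aᶜ, w v y := by
    intro B
    rw [← efz_subsum B (fun v => p v + q v), ← sum_add_distrib]
    apply sum_congr rfl
    intro v _
    simp only [sum_sub_distrib]
    ring
  have huniv : (univ : Finset {v : V // v ∈ A}).map (Function.Embedding.subtype _) = A := by
    ext v; simp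
  have hcutA : ∑ v : {v : V // v ∈ A}, ∑ y ∈ Aᶜ, w v y = efzCut w A := by
    rw [efz_subsum univ (fun v => ∑ y ∈ Aᶜ, w v y), huniv]; rfl
  refine ih {v : V // v ∈ A} _ _ (fun v => p v + ∑ y ∈ Aᶜ, g y v)
    (fun v => q v + ∑ y ∈ Aᶜ, (w v y - g y v)) (univ.filter (fun v => v.1 ∈ X)) ?_ ?_
  · constructor
    · exact fun x y => h.wn _ _
    · exact fun x y => h.ws _ _
    · exact fun x => h.wd _
    · intro x
      exact add_nonneg (h.pn _) (sum_nonneg fun _ _ => g0 _ _)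
    · intro x
      refine add_nonneg (h.qn _) (sum_nonneg fun y _ => ?_)
      have := g1 y x
      rw [h.ws y x] at this
      linarith
    · intro v
      obtain ⟨r, hr⟩ := h.par v
      rw [← Finset.sum_add_sum_compl A] at hr
      rw [efz_subsum univ (fun y => w v y), huniv]
      simp only [sum_sub_distrib, ← mul_sum]
      refine ⟨r - ∑ y ∈ Aᶜ, w v y + ∑ y ∈ Aᶜ, g y v, ?_⟩
      linarith
    · rw [efz_subsum univ (fun v => a v - ∑ y ∈ Aᶜ, (w v y - 2 * g y v)), huniv]
      exact gs
    · intro x hx y hy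
      simp only [mem_filter, mem_univ, true_and] at hx hy
      exact Subtype.ext (h.X1 _ hx _ hy)
    · intro x hx
      simp only [mem_filter, mem_univ, true_and] at hx
      have := hB {x}
      rw [efzB_single] at this
      rw [this]
      simpa [efzB] using h.Xz _ hx
    · intro B b1 b2 b3
      rw [hB]
      unfold efzDD
      rw [hs]
      have := h.cut (B.map (Function.Embedding.subtype _)) (by simpa using b1) (by
        intro e
        apply hA'
        rw [eq_univ_iff_forall] at e ⊢
        intro v
        have := e v
        simp only [mem_map] at this
        obtain ⟨y, _, rfl⟩ := this
        exact y.2) (by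
        intro x hx e
        have hxA : x ∈ A := by
          have : x ∈ B.map (Function.Embedding.subtype _) := by rw [e]; simp
          simp only [mem_map] at this
          obtain ⟨y, _, rfl⟩ := this
          exact y.2
        apply b3 ⟨x, hxA⟩ (by simpa using hx)
        apply Finset.map_injective (Function.Embedding.subtype _)
        rw [e]; simp)
      unfold efzDD at this
      rw [← efz_subcut] at this
      linarith
    · rw [hB, hs, huniv, hcutA]
      unfold efzDD at ht
      linarith
  · unfold efzMu
    rw [hs, huniv, hcutA]
    have c1 : (Fintype.card {v : V // v ∈ A} : ℤ) < Fintype.card V := by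
      rw [Fintype.card_coe]
      exact_mod_cast card_lt_univ_of_notMem
        (not_forall.mp (fun e => hA' (eq_univ_iff_forall.mpr e))).choose_spec
    have c2 : ∑ v ∈ A, (p v + q v) ≤ ∑ v, (p v + q v) :=
      sum_le_univ_sum_of_nonneg fun v => add_nonneg (h.pn v) (h.qn v)
    have c3 : ∑ x : {v : V // v ∈ A}, ∑ y : {v : V // v ∈ A}, w x y + efzCut w A ≤
        ∑ x, ∑ y, w x y := by
      rw [← hcutA, ← sum_add_distrib]
      have : ∀ x : {v : V // v ∈ A}, ∑ y : {v : V // v ∈ A}, w x y + ∑ y ∈ Aᶜ, w x y =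
          ∑ y, w x y := by
        intro x
        rw [efz_subsum univ (fun y => w x y), huniv, Finset.sum_add_sum_compl]
      rw [sum_congr rfl (fun x _ => this x), efz_subsum univ (fun x => ∑ y, w x y), huniv]
      exact sum_le_univ_sum_of_nonneg fun v => sum_nonneg fun _ _ => h.wn _ _
    have c4 : 0 ≤ efzCut w A := sum_nonneg fun _ _ => sum_nonneg fun _ _ => h.wn _ _
    have c5 := mul_le_mul_of_nonneg_left c3 hk.le
    have c6 : efzCut w A ≤ k * efzCut w A := by nlinarith
    linarith


lemma efzD_row {V : Type*} [Fintype V] [DecidableEq V] (x y s : V) :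
    ∑ t, efzD x y s t = efzC x s + efzC y s := by
  simp only [efzD, sum_add_distrib, ← mul_sum, efzC_sum_univ]; ring

lemma efzD_le {V : Type*} [DecidableEq V] {w : V → V → ℤ} (wn : ∀ x y, 0 ≤ w x y)
    (ws : ∀ x y, w x y = w y x) {x y : V} (hxy : x ≠ y) (h : 1 ≤ w x y) (s t : V) :
    efzD x y s t ≤ w s t := by
  have h0 := wn s t
  by_cases h1 : s = x ∧ t = y
  · obtain ⟨rfl, rfl⟩ := h1
    simp [efzD, efzC, hxy, h]
  · by_cases h2 : s = y ∧ t = x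
    · obtain ⟨rfl, rfl⟩ := h2
      rw [ws]
      simp [efzD, efzC, hxy.symm, h]
    · have : efzD x y s t = 0 := by
        unfold efzD efzC
        split_ifs <;> simp_all
      rw [this]; exact h0

lemma efzI_cases {V : Type*} [DecidableEq V] (A : Finset V) (x : V) :
    (x ∈ A ∧ efzI A x = 1) ∨ (x ∉ A ∧ efzI A x = 0) := by
  by_cases h : x ∈ A <;> simp [efzI, h]

lemma efz_two_le {V : Type*} [DecidableEq V] {A : Finset V} {x y : V} (hx : x ∈ A) (hy : y ∈ A)
    (h : x ≠ y) : 2 ≤ A.card := by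
  have : ({x, y} : Finset V) ⊆ A := by
    intro z hz
    simp only [mem_insert, mem_singleton] at hz
    rcases hz with rfl | rfl <;> assumption
  have := card_le_card this
  rwa [card_pair h] at this

lemma efz_two_le' {V : Type*} [DecidableEq V] {A : Finset V} {x : V} (hx : x ∈ A)
    (h : A ≠ {x}) : 2 ≤ A.card := by
  by_contra hc
  apply h
  have h1 : A.card = 1 := by
    have := card_pos.mpr ⟨x, hx⟩
    omega
  obtain ⟨y, rfl⟩ := card_eq_one.mp h1
  simp at hx; rw [hx]

section
universe u
variable {V : Type u} [Fintype V] [DecidableEq V] {k : ℤ}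
    {w : V → V → ℤ} {a p q : V → ℤ} {X : Finset V}

lemma efz_step2_lift (hk : 0 < k) {x : V} (h : EfzInst k w a p q {x})
    (ih : EfzIH.{u} k (efzMu k w p q))
    (hsl : ∀ A : Finset V, 2 ≤ A.card → A ≠ univ →
      2 * k + efzTau k (efzB a p q A) ≤ efzDD w p q A)
    {u v : V} (huv : u ≠ v) (hu : 1 ≤ w x u) (hv : 1 ≤ w x v) : EfzOri k w a := by
  have hux : u ≠ x := by rintro rfl; have := h.wd u; omega
  have hvx : v ≠ x := by rintro rfl; have := h.wd v; omega
  apply efz_lift huv (h.wn u v) hux hvx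
  have l1 : ∀ s t, 0 ≤ w s t - efzD x u s t := fun s t => by
    have := efzD_le h.wn h.ws hux.symm hu s t
    linarith
  have l2 : ∀ s t, 0 ≤ w s t - efzD x u s t - efzD x v s t := fun s t => by
    have := efzD_le (w := fun s t => w s t - efzD x u s t) l1
      (fun s t => by rw [h.ws s t, efzD_symm]) hvx.symm (by
        simp [efzD, efzC, huv.symm, hvx, hv]) s t
    linarith
  have dn : ∀ s t, 0 ≤ efzD u v s t := fun s t => by
    unfold efzD efzC; split_ifs <;> simp
  refine ih V _ _ p q {x} ?_ ?_
  · constructor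
    · intro s t; have := l2 s t; have := dn s t; linarith
    · intro s t; rw [h.ws s t, efzD_symm x u, efzD_symm x v, efzD_symm u v]
    · intro s; rw [h.wd, efzD_diag hux.symm, efzD_diag hvx.symm, efzD_diag huv]; rfl
    · exact h.pn
    · exact h.qn
    · intro s
      obtain ⟨r, hr⟩ := h.par s
      simp only [sum_add_distrib, sum_sub_distrib, efzD_row]
      exact ⟨r - efzC x s, by linarith⟩
    · exact h.sum
    · exact h.X1
    · exact h.Xz
    · intro A h1 h2 h3
      have hA := h3 x (by simp)
      have hc := h.cut A h1 h2 h3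
      unfold efzDD at hc hsl ⊢
      rw [efzCut_add, efzCut_sub, efzCut_sub, efzD_cut, efzD_cut, efzD_cut]
      have hS := hsl A
      rcases efzI_cases A x with ⟨m1, e1⟩ | ⟨m1, e1⟩ <;> rcases efzI_cases A u with ⟨m2, e2⟩ | ⟨m2, e2⟩
        <;> rcases efzI_cases A v with ⟨m3, e3⟩ | ⟨m3, e3⟩ <;> rw [e1, e2, e3]
      · linarith
      · linarith
      · linarith
      · have := hS (efz_two_le' m1 hA) h2; linarith
      · have := hS (efz_two_le m2 m3 huv) h2; linarith
      · linarith
      · linarith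
      · linarith
    · exact h.top
  · unfold efzMu
    simp only [sum_add_distrib, sum_sub_distrib, efzD_row, efzC_sum_univ]
    linarith

lemma efz_step2_arc (hk : 0 < k) {x : V} (h : EfzInst k w a p q {x})
    (ih : EfzIH.{u} k (efzMu k w p q))
    (hsl : ∀ A : Finset V, 2 ≤ A.card → A ≠ univ →
      2 * k + efzTau k (efzB a p q A) ≤ efzDD w p q A)
    {u : V} (hu : 1 ≤ w x u) (hp : 1 ≤ p x) : EfzOri k w a := by
  have hux : u ≠ x := by rintro rfl; have := h.wd u; omega
  apply efz_del x u
  have hB : ∀ A, efzB (fun v => a v - efzC x v + efzC u v) (fun v => p v - efzC x v + efzC u v) q A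
      = efzB a p q A := by
    intro A; unfold efzB; apply sum_congr rfl; intros; ring
  refine ih V _ _ (fun v => p v - efzC x v + efzC u v) q {x} ?_ ?_
  · constructor
    · intro s t; have := efzD_le h.wn h.ws hux.symm hu s t; linarith
    · intro s t; rw [h.ws s t, efzD_symm x u]
    · intro s; rw [h.wd, efzD_diag hux.symm]; rfl
    · intro s
      have := h.pn s
      unfold efzC
      by_cases e : s = x
      · subst e; split_ifs <;> omega
      · split_ifs <;> omega
    · exact h.qn
    · intro s
      obtain ⟨r, hr⟩ := h.par s
      simp only [sum_sub_distrib, efzD_row]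
      exact ⟨r - efzC x s, by linarith⟩
    · simp only [sum_add_distrib, sum_sub_distrib, efzC_sum_univ]
      simpa using h.sum
    · exact h.X1
    · intro s hs
      obtain ⟨c, hc⟩ := h.Xz s hs
      exact ⟨c, by linarith⟩
    · intro A h1 h2 h3
      have hA := h3 x (by simp)
      have hc := h.cut A h1 h2 h3
      rw [hB]
      unfold efzDD at hc hsl ⊢
      rw [efzCut_sub, efzD_cut]
      have hS := hsl A
      simp only [sum_add_distrib, sum_sub_distrib, efzC_sum] at hc hS ⊢
      rcases efzI_cases A x with ⟨m1, e1⟩ | ⟨m1, e1⟩ <;>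
        rcases efzI_cases A u with ⟨m2, e2⟩ | ⟨m2, e2⟩ <;> rw [e1, e2]
      · linarith
      · have := hS (efz_two_le' m1 hA) h2; linarith
      · linarith
      · linarith
    · rw [hB]
      have := h.top
      simp only [sum_add_distrib, sum_sub_distrib, efzC_sum_univ] at this ⊢
      linarith
  · unfold efzMu
    simp only [sum_add_distrib, sum_sub_distrib, efzD_row, efzC_sum_univ]
    linarith

lemma efz_step2_remove (hk : 0 < k) {x : V} (h : EfzInst k w a p q {x})
    (ih : EfzIH.{u} k (efzMu k w p q))
    {u : V} (hux : u ≠ x) (hu : ∀ y, y ≠ u → w x y = 0) (hp : p x = 0) (hq : q x = 0) :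
    EfzOri k w a := by
  have hax : 2 * k ∣ a x := by
    have := h.Xz x (by simp)
    rw [hp, hq] at this
    simpa using this
  have hev : Even (w x u) := by
    have h1 : ∑ y, w x y = w x u :=
      Finset.sum_eq_single u (fun y _ hy => hu y hy) (by simp)
    have := h.par x
    rw [h1] at this
    obtain ⟨r, hr⟩ := this
    obtain ⟨c, hc⟩ := hax
    refine ⟨r - k * c, ?_⟩
    linarith
  apply efz_combine {x, u} h.wn h.ws h.wd (efz_quot_ori hk h ih {x, u} (by
    rw [card_pair hux.symm]))
  intro g g0 g1 gs
  have hx0 : ∑ y ∈ ({x, u} : Finset V)ᶜ, (w x y - 2 * g y x) = 0 := by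
    apply sum_eq_zero
    intro y hy
    simp only [mem_compl, mem_insert, mem_singleton, not_or] at hy
    have h1 := hu y hy.2
    have h2 := g1 y x
    have h3 := g0 y x
    rw [h.ws y x] at h2
    omega
  rw [sum_pair hux.symm, hx0, sub_zero] at gs
  have hau := (Int.dvd_add_right hax).mp gs
  have hevA : ∀ s t : {v : V // v ∈ ({x, u} : Finset V)}, Even (w s t) := by
    rintro ⟨s, hs⟩ ⟨t, ht⟩
    simp only [mem_insert, mem_singleton] at hs ht
    rcases hs with rfl | rfl <;> rcases ht with rfl | rfl
    · simp [h.wd]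
    · exact hev
    · rw [h.ws]; exact hev
    · simp [h.wd]
  refine ⟨fun s t => w s t / 2, ?_, ?_, ?_⟩
  · intro s t; have := h.wn s t; dsimp only; omega
  · intro s t
    obtain ⟨r, hr⟩ := hevA s t
    dsimp only
    rw [h.ws t s]; omega
  · rintro ⟨s, hs⟩
    have e : ∑ y : {v : V // v ∈ ({x, u} : Finset V)}, (w s y / 2 - w y s / 2) = 0 := by
      apply sum_eq_zero
      intro y _
      rw [h.ws y s]; ring
    rw [e, zero_sub]
    apply Int.dvd_neg.mpr
    have hs' := hs
    simp only [mem_insert, mem_singleton] at hs'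
    rcases hs' with rfl | rfl
    · simp only [hx0]; simpa using hax
    · exact hau

lemma efzCut_single_zero {x : V} (h0 : ∀ y, w x y = 0) (ws : ∀ x y, w x y = w y x) :
    efzCut w {x}ᶜ = 0 := by
  unfold efzCut
  apply sum_eq_zero
  intro y _
  simp [ws y x, h0]

lemma efz_step2 (hk : 0 < k) {x : V} (h : EfzInst k w a p q {x})
    (hcard : 2 ≤ Fintype.card V)
    (ih : EfzIH.{u} k (efzMu k w p q))
    (hsl : ∀ A : Finset V, 2 ≤ A.card → A ≠ univ →
      2 * k + efzTau k (efzB a p q A) ≤ efzDD w p q A) : EfzOri k w a := by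
  by_cases c1 : ∃ u v, u ≠ v ∧ 1 ≤ w x u ∧ 1 ≤ w x v
  · obtain ⟨u, v, h1, h2, h3⟩ := c1
    exact efz_step2_lift hk h ih hsl h1 h2 h3
  by_cases c2 : ∃ u, 1 ≤ w x u
  · obtain ⟨u, hu⟩ := c2
    have hux : u ≠ x := by rintro rfl; have := h.wd u; omega
    by_cases c3 : 1 ≤ p x
    · exact efz_step2_arc hk h ih hsl hu c3
    by_cases c4 : 1 ≤ q x
    · apply efz_rev_ori
      refine efz_step2_arc hk (h.rev hk) (by rw [efzMu_rev]; exact ih) ?_ hu c4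
      intro A; rw [efzB_rev, efzTau_neg hk, efzDD_rev]; exact hsl A
    · refine efz_step2_remove hk h ih hux ?_ (by have := h.pn x; omega) (by have := h.qn x; omega)
      intro y hy
      by_contra hne
      have := h.wn x y
      exact c1 ⟨y, u, hy, by omega, hu⟩
  · have h0 : ∀ y, w x y = 0 := fun y => by
      have := h.wn x y
      by_contra hne
      exact c2 ⟨y, by omega⟩
    obtain ⟨u, hux⟩ := Fintype.exists_ne_of_one_lt_card (by omega) x
    have hc := h.cut {x}ᶜ ⟨u, by simpa using hux⟩ (by
      intro e
      have := eq_univ_iff_forall.mp e x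
      simp at this) (by
      intro z hz e
      simp only [mem_singleton] at hz
      subst hz
      have : z ∈ ({z} : Finset V)ᶜ := by rw [e]; simp
      simp at this)
    have e1 := efzB_compl a p q {x}
    have e2 : efzTau k (efzB a p q univ) = efzTau k (efzB a p q {x}ᶜ) := by
      apply efzTau_congr
      rw [← e1, add_sub_cancel_right, efzB_single]
      exact h.Xz x (by simp)
    have e3 := Finset.sum_add_sum_compl {x} (fun v => p v + q v)
    have ht := h.top
    unfold efzDD at hc
    rw [efzCut_single_zero h0 h.ws] at hc
    rw [sum_singleton] at e3
    have := h.pn x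
    have := h.qn x
    exact efz_step2_remove hk h ih hux (fun y _ => h0 y) (by linarith) (by linarith)

end


section
universe u
variable {V : Type u} [Fintype V] [DecidableEq V] {k : ℤ}
    {w : V → V → ℤ} {a p q : V → ℤ} {X : Finset V}

lemma efz_step4_del (hk : 0 < k) (h : EfzInst k w a p q ∅)
    (ih : EfzIH.{u} k (efzMu k w p q))
    (hsl : ∀ A : Finset V, 2 ≤ A.card → A ≠ univ →
      2 * k + efzTau k (efzB a p q A) ≤ efzDD w p q A)
    {x y : V} (hxy : 1 ≤ w x y)
    (hx : 2 * k - 2 + efzTau k (efzB a p q {x} - 1) ≤ efzDD w p q {x} - 1)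
    (hy : 2 * k - 2 + efzTau k (efzB a p q {y} + 1) ≤ efzDD w p q {y} - 1) :
    EfzOri k w a := by
  have hne : x ≠ y := by rintro rfl; have := h.wd x; omega
  apply efz_del x y
  have hB : ∀ A, efzB (fun v => a v - efzC x v + efzC y v) p q A
      = efzB a p q A - efzI A x + efzI A y := by
    intro A; unfold efzB
    simp only [sum_add_distrib, sum_sub_distrib, efzC_sum]; ring
  refine ih V _ _ p q ∅ ?_ ?_
  · constructor
    · intro s t; have := efzD_le h.wn h.ws hne hxy s t; linarith
    · intro s t; rw [h.ws s t, efzD_symm x y]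
    · intro s; rw [h.wd, efzD_diag hne]; rfl
    · exact h.pn
    · exact h.qn
    · intro s
      obtain ⟨r, hr⟩ := h.par s
      simp only [sum_sub_distrib, efzD_row]
      exact ⟨r - efzC x s, by linarith⟩
    · simp only [sum_add_distrib, sum_sub_distrib, efzC_sum_univ]
      simpa using h.sum
    · exact h.X1
    · intro s hs; simp at hs
    · intro A h1 h2 h3
      have hc := h.cut A h1 h2 h3
      rw [hB]
      unfold efzDD at hc hsl hx hy ⊢
      rw [efzCut_sub, efzD_cut]
      have hS := hsl A
      rcases efzI_cases A x with ⟨m1, e1⟩ | ⟨m1, e1⟩ <;>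
        rcases efzI_cases A y with ⟨m2, e2⟩ | ⟨m2, e2⟩ <;> rw [e1, e2]
      · rw [sub_add_cancel]; linarith
      · by_cases hA : A = {x}
        · subst hA; rw [add_zero]; linarith
        · have := hS (efz_two_le' m1 hA) h2
          have := efzTau_step hk (efzB a p q A) (efzB a p q A - 1 + 0)
          rw [show efzB a p q A - 1 + 0 - efzB a p q A = -1 by ring] at this
          norm_num at this ⊢
          linarith
      · by_cases hA : A = {y}
        · subst hA; rw [sub_zero]; linarith
        · have := hS (efz_two_le' m2 hA) h2
          have := efzTau_step hk (efzB a p q A) (efzB a p q A - 0 + 1)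
          rw [show efzB a p q A - 0 + 1 - efzB a p q A = 1 by ring] at this
          norm_num at this ⊢
          linarith
      · rw [sub_zero, add_zero]; linarith
    · rw [hB]
      have := h.top
      simpa [efzI] using this
  · unfold efzMu
    simp only [sum_sub_distrib, efzD_row, sum_add_distrib, efzC_sum_univ]
    linarith

lemma efz_step4_arc (hk : 0 < k) (h : EfzInst k w a p q ∅)
    (ih : EfzIH.{u} k (efzMu k w p q))
    (hsl : ∀ A : Finset V, 2 ≤ A.card → A ≠ univ →
      2 * k + efzTau k (efzB a p q A) ≤ efzDD w p q A)
    {x : V} (hq : 1 ≤ q x)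
    (hx : 2 * k - 2 + efzTau k (efzB a p q {x} - 1) ≤ efzDD w p q {x} - 1) :
    EfzOri k w a := by
  have hB : ∀ A, efzB a p (fun v => q v - efzC x v) A = efzB a p q A - efzI A x := by
    intro A; unfold efzB
    simp only [sum_add_distrib, sum_sub_distrib, efzC_sum]; ring
  refine ih V w a p (fun v => q v - efzC x v) ∅ ?_ ?_
  · constructor
    · exact h.wn
    · exact h.ws
    · exact h.wd
    · exact h.pn
    · intro s
      have := h.qn s
      unfold efzC
      split_ifs with e
      · subst e; omega
      · omega
    · exact h.par
    · exact h.sum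
    · exact h.X1
    · intro s hs; simp at hs
    · intro A h1 h2 h3
      have hc := h.cut A h1 h2 h3
      rw [hB]
      unfold efzDD at hc hsl hx ⊢
      have hS := hsl A
      simp only [sum_add_distrib, sum_sub_distrib, efzC_sum] at hc hS hx ⊢
      rcases efzI_cases A x with ⟨m1, e1⟩ | ⟨m1, e1⟩ <;> rw [e1]
      · by_cases hA : A = {x}
        · subst hA; linarith
        · have := hS (efz_two_le' m1 hA) h2
          have := efzTau_step hk (efzB a p q A) (efzB a p q A - 1)
          rw [show efzB a p q A - 1 - efzB a p q A = -1 by ring] at this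
          norm_num at this ⊢
          linarith
      · rw [sub_zero]; linarith
    · rw [hB]
      have := h.top
      have h2 := efzTau_step hk (efzB a p q univ - 1) (efzB a p q univ)
      rw [show efzB a p q univ - (efzB a p q univ - 1) = 1 by ring] at h2
      have e : efzI univ x = 1 := by simp [efzI]
      rw [e]
      simp only [sum_add_distrib, sum_sub_distrib, efzC_sum_univ] at this ⊢
      norm_num at h2
      linarith
  · unfold efzMu
    simp only [sum_sub_distrib, sum_add_distrib, efzC_sum_univ]
    linarith

lemma efz_step4_W (hk : 2 ≤ k) (h : EfzInst k w a p q ∅)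
    (ih : EfzIH.{u} k (efzMu k w p q))
    {x y : V} (hxy : 1 ≤ w x y)
    (ht : ∑ v, (p v + q v) + 2 ≤ 2 * k - 2 + efzTau k (efzB a p q univ)) :
    EfzOri k w a := by
  have hne : x ≠ y := by rintro rfl; have := h.wd x; omega
  apply efz_del x y
  have hB : ∀ A, efzB (fun v => a v - efzC x v + efzC y v) (fun v => p v + efzC y v)
      (fun v => q v + efzC x v) A = efzB a p q A := by
    intro A; unfold efzB
    apply sum_congr rfl; intros; ring
  have hC : ∀ x v : V, 0 ≤ efzC x v := fun x v => by unfold efzC; split_ifs <;> simp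
  refine ih V _ _ (fun v => p v + efzC y v) (fun v => q v + efzC x v) ∅ ?_ ?_
  · constructor
    · intro s t; have := efzD_le h.wn h.ws hne hxy s t; linarith
    · intro s t; rw [h.ws s t, efzD_symm x y]
    · intro s; rw [h.wd, efzD_diag hne]; rfl
    · intro s; exact add_nonneg (h.pn s) (hC _ _)
    · intro s; exact add_nonneg (h.qn s) (hC _ _)
    · intro s
      obtain ⟨r, hr⟩ := h.par s
      simp only [sum_sub_distrib, efzD_row]
      exact ⟨r - efzC x s, by linarith⟩
    · simp only [sum_add_distrib, sum_sub_distrib, efzC_sum_univ]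
      simpa using h.sum
    · exact h.X1
    · intro s hs; simp at hs
    · intro A h1 h2 h3
      have hc := h.cut A h1 h2 h3
      rw [hB]
      unfold efzDD at hc ⊢
      rw [efzCut_sub, efzD_cut]
      simp only [sum_add_distrib, efzC_sum] at hc ⊢
      rcases efzI_cases A x with ⟨m1, e1⟩ | ⟨m1, e1⟩ <;>
        rcases efzI_cases A y with ⟨m2, e2⟩ | ⟨m2, e2⟩ <;> rw [e1, e2] <;> linarith
    · rw [hB]
      simp only [sum_add_distrib, efzC_sum_univ] at ht ⊢
      linarith
  · unfold efzMu
    simp only [sum_sub_distrib, efzD_row, sum_add_distrib, efzC_sum_univ]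
    linarith

lemma efz_step4_F (hk : 2 ≤ k) (h : EfzInst k w a p q ∅)
    (ih : EfzIH.{u} k (efzMu k w p q))
    (hsl : ∀ A : Finset V, 2 ≤ A.card → A ≠ univ →
      2 * k + efzTau k (efzB a p q A) ≤ efzDD w p q A)
    {x y : V} (hxy : 1 ≤ w x y)
    (hx : 2 * k - 2 + efzTau k (efzB a p q {x} - 1) ≤ efzDD w p q {x} - 1)
    {t j : ℤ} (ht1 : 1 ≤ t) (htk : t ≤ k - 1) (hb : efzB a p q {y} = t + 2 * k * j)
    (hd : efzDD w p q {y} = 2 * k - 2 + t)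
    (hD : ∑ v, (p v + q v) = 2 * k - 1) {i : ℤ} (hu : efzB a p q univ = 1 + 2 * k * i) :
    EfzOri k w a := by
  have hk0 : 0 < k := by omega
  have hne : x ≠ y := by rintro rfl; have := h.wd x; omega
  apply efz_del x y
  have hB : ∀ A, efzB (fun v => a v - efzC x v + efzC y v) p
      (fun v => q v + (k - t) * efzC y v) A =
      efzB a p q A - efzI A x + efzI A y + (k - t) * efzI A y := by
    intro A; unfold efzB
    simp only [sum_add_distrib, sum_sub_distrib, ← mul_sum, efzC_sum]; ring
  have hC : ∀ x v : V, 0 ≤ efzC x v := fun x v => by unfold efzC; split_ifs <;> simp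
  refine ih V _ _ p (fun v => q v + (k - t) * efzC y v) ∅ ?_ ?_
  · constructor
    · intro s t; have := efzD_le h.wn h.ws hne hxy s t; linarith
    · intro s t; rw [h.ws s t, efzD_symm x y]
    · intro s; rw [h.wd, efzD_diag hne]; rfl
    · exact h.pn
    · intro s; exact add_nonneg (h.qn s) (mul_nonneg (by omega) (hC _ _))
    · intro s
      obtain ⟨r, hr⟩ := h.par s
      simp only [sum_sub_distrib, efzD_row]
      exact ⟨r - efzC x s, by linarith⟩
    · simp only [sum_add_distrib, sum_sub_distrib, efzC_sum_univ]
      simpa using h.sum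
    · exact h.X1
    · intro s hs; simp at hs
    · intro A h1 h2 h3
      have hc := h.cut A h1 h2 h3
      rw [hB]
      unfold efzDD at hc hsl hx hd ⊢
      rw [efzCut_sub, efzD_cut]
      have hS := hsl A
      simp only [sum_add_distrib, ← mul_sum, efzC_sum] at hc hS hx hd ⊢
      rcases efzI_cases A x with ⟨m1, e1⟩ | ⟨m1, e1⟩ <;>
        rcases efzI_cases A y with ⟨m2, e2⟩ | ⟨m2, e2⟩ <;> rw [e1, e2]
      · have h4 := efzTau_step hk0 (efzB a p q A) (efzB a p q A - 1 + 1 + (k - t) * 1)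
        rw [show efzB a p q A - 1 + 1 + (k - t) * 1 - efzB a p q A = k - t by ring,
          abs_of_nonneg (by omega)] at h4
        linarith
      · by_cases hA : A = {x}
        · subst hA
          rw [show efzB a p q {x} - 1 + 0 + (k - t) * 0 = efzB a p q {x} - 1 by ring]
          linarith
        · have h5 := hS (efz_two_le' m1 hA) h2
          have h4 := efzTau_step hk0 (efzB a p q A) (efzB a p q A - 1 + 0 + (k - t) * 0)
          rw [show efzB a p q A - 1 + 0 + (k - t) * 0 - efzB a p q A = -1 by ring, abs_neg,
            abs_one] at h4
          linarith
      · by_cases hA : A = {y}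
        · subst hA
          have h4 := efzTau_le hk0 (efzB a p q {y} - 0 + 1 + (k - t) * 1) (j + 1)
          rw [hb] at h4 ⊢
          rw [show t + 2 * k * j - 0 + 1 + (k - t) * 1 - 2 * k * (j + 1) = - (k - 1) by ring,
            abs_neg, abs_of_nonneg (by omega)] at h4
          linarith
        · have h5 := hS (efz_two_le' m2 hA) h2
          have h4 := efzTau_step hk0 (efzB a p q A) (efzB a p q A - 0 + 1 + (k - t) * 1)
          rw [show efzB a p q A - 0 + 1 + (k - t) * 1 - efzB a p q A = 1 + (k - t) by ring,
            abs_of_nonneg (by omega)] at h4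
          linarith
      · rw [show efzB a p q A - 0 + 0 + (k - t) * 0 = efzB a p q A by ring]; linarith
    · rw [hB]
      have e : ∀ x : V, efzI univ x = 1 := fun x => by simp [efzI]
      rw [e, e, hu]
      have h4 : efzTau k (1 + 2 * k * i - 1 + 1 + (k - t) * 1) = 1 + (k - t) := by
        have e2 : 1 + 2 * k * i - 1 + 1 + (k - t) * 1 - 2 * k * i = 1 + (k - t) := by ring
        have e3 : |1 + (k - t)| = 1 + (k - t) := abs_of_nonneg (by omega)
        rw [efzTau_eq hk0 (j := i), e2, e3]
        rw [e2, e3]; omega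
      rw [h4]
      simp only [sum_add_distrib, ← mul_sum, efzC_sum_univ] at hD ⊢
      linarith
  · unfold efzMu
    simp only [sum_sub_distrib, efzD_row, sum_add_distrib, ← mul_sum, efzC_sum_univ]
    linarith

lemma efzCut_compl (ws : ∀ x y, w x y = w y x) (A : Finset V) :
    efzCut w Aᶜ = efzCut w A := by
  unfold efzCut
  rw [compl_compl, sum_comm]
  exact sum_congr rfl fun _ _ => sum_congr rfl fun _ _ => ws _ _

/-- there is an edge across every proper vertex set -/
lemma efz_nosplit (hk : 2 ≤ k) (h : EfzInst k w a p q ∅) (S : Finset V) (h1 : S.Nonempty)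
    (h2 : Sᶜ.Nonempty) : ∃ x ∈ S, ∃ y ∉ S, 1 ≤ w x y := by
  by_contra hcon
  push Not at hcon
  have hk0 : 0 < k := by omega
  have hz : efzCut w S = 0 := by
    apply sum_eq_zero
    intro x hx
    apply sum_eq_zero
    intro y hy
    have := hcon x hx y (mem_compl.mp hy)
    have := h.wn x y
    omega
  have c1 := h.cut S h1 (by
    rintro rfl; simp at h2) (by simp)
  have c2 := h.cut Sᶜ h2 (by
    intro e
    rw [compl_eq_univ_iff] at e; subst e; simp at h1) (by simp)
  unfold efzDD at c1 c2
  rw [efzCut_compl h.ws] at c2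
  have e1 := efzB_compl a p q S
  have e2 := Finset.sum_add_sum_compl S (fun v => p v + q v)
  have := efzTau_add hk0 (efzB a p q S) (efzB a p q Sᶜ)
  rw [e1] at this
  have := h.top
  linarith

lemma efz_final (hk : 2 ≤ k) (h : EfzInst k w a p q ∅)
    (hcard : 2 ≤ Fintype.card V)
    (ih : EfzIH.{u} k (efzMu k w p q))
    (hsl : ∀ A : Finset V, 2 ≤ A.card → A ≠ univ →
      2 * k + efzTau k (efzB a p q A) ≤ efzDD w p q A)
    (hz : ∀ v, ¬ 2 * k ∣ efzB a p q {v})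
    (h1 : ∀ x, 2 * k - 2 + efzTau k (efzB a p q {x} - 1) ≤ efzDD w p q {x} - 1)
    (h2 : ∀ x, ¬ 2 * k - 2 + efzTau k (efzB a p q {x} + 1) ≤ efzDD w p q {x} - 1) :
    EfzOri k w a := by
  have hk0 : 0 < k := by omega
  by_cases hq : ∃ x, 1 ≤ q x
  · obtain ⟨x, hx⟩ := hq
    exact efz_step4_arc hk0 h ih hsl hx (h1 x)
  have hq0 : ∀ x, q x = 0 := fun x => by
    have := h.qn x
    by_contra hne
    exact hq ⟨x, by omega⟩
  obtain ⟨z, z', hzz⟩ := Fintype.exists_pair_of_one_lt_card (α := V) (by omega)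
  obtain ⟨x, _, y, _, hxy⟩ := efz_nosplit hk h {z} (by simp) ⟨z', by simpa using hzz.symm⟩
  by_cases hW : ∑ v, (p v + q v) + 2 ≤ 2 * k - 2 + efzTau k (efzB a p q univ)
  · exact efz_step4_W hk h ih hxy hW
  have htop := h.top
  have hpar := h.parity univ
  have hDD : efzDD w p q univ = ∑ v, (p v + q v) := by simp [efzDD, efzCut]
  have hBu : efzB a p q univ = ∑ v, a v - ∑ v, (p v + q v) := by
    unfold efzB; rw [← sum_sub_distrib]; apply sum_congr rfl; intro v _; rw [hq0]; ring
  rw [hDD] at hpar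
  obtain ⟨c, hc⟩ := h.sum
  set D := ∑ v, (p v + q v) with hDdef
  have hDn : 0 ≤ D := sum_nonneg fun v _ => add_nonneg (h.pn v) (h.qn v)
  have htau : efzTau k (efzB a p q univ) = efzTau k D := by
    rw [← efzTau_neg hk0 D]
    apply efzTau_congr
    rw [hBu, hc]
    exact ⟨c, by ring⟩
  have htp := efzTau_parity hk0 (efzB a p q univ)
  have t0 := efzTau_nonneg hk0 D
  have tk := efzTau_le_k (k := k) D
  rw [htau] at htop hW htp
  have hDeq : D = 2 * k - 2 + efzTau k D := by
    rw [Int.even_iff] at hpar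
    omega
  have ht1 : efzTau k D = 1 := by
    by_contra hne
    rcases lt_or_gt_of_ne hne with hlt | hgt
    · have e0 : efzTau k D = 0 := by omega
      have e1 : D = 2 * k - 2 := by omega
      have e2 := efzTau_eq hk0 (m := D) (j := 1)
        (by rw [e1, show 2 * k - 2 - 2 * k * 1 = -2 by ring]; simpa using hk)
      rw [e0, e1, show 2 * k - 2 - 2 * k * 1 = -2 by ring] at e2
      norm_num at e2
    · have e := efzTau_le hk0 D 1
      rw [show D - 2 * k * 1 = efzTau k D - 2 by omega, abs_of_nonneg (by omega)] at e
      omega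
  have hD1 : D = 2 * k - 1 := by omega
  -- the vertex y
  have hy2 := h2 y
  have hcy := h.cut {y} (by simp) (by
    intro e
    have := congrArg Finset.card e
    rw [card_singleton, card_univ] at this
    omega) (by simp)
  have hst := efzTau_step hk0 (efzB a p q {y}) (efzB a p q {y} + 1)
  rw [add_sub_cancel_left, abs_one] at hst
  have htpos := efzTau_pos hk0 (hz y)
  have hpy := h.parity {y}
  have hpt := efzTau_parity hk0 (efzB a p q {y})
  have hpt1 := efzTau_parity hk0 (efzB a p q {y} + 1)
  have htk1 := efzTau_le_k (k := k) (efzB a p q {y} + 1)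
  rw [Int.even_iff] at hpy
  obtain ⟨j, hj⟩ := efzTau_up hk0 (m := efzB a p q {y}) (by omega)
  refine efz_step4_F hk h ih hsl hxy (h1 x) (t := efzTau k (efzB a p q {y})) (j := j)
    (by omega) (by omega) hj (by omega) hD1 (i := c - 1) ?_
  rw [hBu, hc, hD1]; ring

lemma efz_step4 (hk : 2 ≤ k) (h : EfzInst k w a p q ∅)
    (hcard : 2 ≤ Fintype.card V)
    (ih : EfzIH.{u} k (efzMu k w p q))
    (hsl : ∀ A : Finset V, 2 ≤ A.card → A ≠ univ →
      2 * k + efzTau k (efzB a p q A) ≤ efzDD w p q A)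
    (hz : ∀ v, ¬ 2 * k ∣ efzB a p q {v}) :
    EfzOri k w a := by
  have hk0 : 0 < k := by omega
  by_cases c1 : ∃ x y, 1 ≤ w x y ∧
      2 * k - 2 + efzTau k (efzB a p q {x} - 1) ≤ efzDD w p q {x} - 1 ∧
      2 * k - 2 + efzTau k (efzB a p q {y} + 1) ≤ efzDD w p q {y} - 1
  · obtain ⟨x, y, e1, e2, e3⟩ := c1
    exact efz_step4_del hk0 h ih hsl e1 e2 e3
  have hor : ∀ x, 2 * k - 2 + efzTau k (efzB a p q {x} - 1) ≤ efzDD w p q {x} - 1 ∨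
      2 * k - 2 + efzTau k (efzB a p q {x} + 1) ≤ efzDD w p q {x} - 1 := by
    intro x
    have hcx := h.cut {x} (by simp) (by
      intro e
      have := congrArg Finset.card e
      rw [card_singleton, card_univ] at this
      omega) (by simp)
    rcases efzTau_down hk0 (hz x) with e | e
    · left; linarith
    · right; linarith
  classical
  let S : Finset V := univ.filter (fun x =>
    2 * k - 2 + efzTau k (efzB a p q {x} - 1) ≤ efzDD w p q {x} - 1)
  have hnb : ∀ x, ∃ y, 1 ≤ w x y := by
    intro x
    obtain ⟨u, hu⟩ := Fintype.exists_ne_of_one_lt_card (by omega) x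
    obtain ⟨x', hx', y, _, hy⟩ := efz_nosplit hk h {x} (by simp) ⟨u, by simpa using hu⟩
    simp only [mem_singleton] at hx'
    subst hx'
    exact ⟨y, hy⟩
  -- no vertex satisfies both
  have hboth : ∀ x, ¬ (2 * k - 2 + efzTau k (efzB a p q {x} - 1) ≤ efzDD w p q {x} - 1 ∧
      2 * k - 2 + efzTau k (efzB a p q {x} + 1) ≤ efzDD w p q {x} - 1) := by
    rintro x ⟨e1, e2⟩
    obtain ⟨y, hy⟩ := hnb x
    rcases hor y with e | e
    · exact c1 ⟨y, x, by rw [h.ws]; exact hy, e, e2⟩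
    · exact c1 ⟨x, y, hy, e1, e⟩
  by_cases hS : S.Nonempty
  · by_cases hS' : Sᶜ.Nonempty
    · exfalso
      obtain ⟨x, hx, y, hy, hxy⟩ := efz_nosplit hk h S hS hS'
      simp only [S, mem_filter, mem_univ, true_and] at hx hy
      exact c1 ⟨x, y, hxy, hx, (hor y).resolve_left hy⟩
    · rw [not_nonempty_iff_eq_empty, compl_eq_empty_iff, eq_univ_iff_forall] at hS'
      have h1 : ∀ x, 2 * k - 2 + efzTau k (efzB a p q {x} - 1) ≤ efzDD w p q {x} - 1 := by
        intro x
        simpa [S] using hS' x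
      exact efz_final hk h hcard ih hsl hz h1 (fun x e => hboth x ⟨h1 x, e⟩)
  · rw [not_nonempty_iff_eq_empty] at hS
    have h1 : ∀ x, ¬ 2 * k - 2 + efzTau k (efzB a p q {x} - 1) ≤ efzDD w p q {x} - 1 := by
      intro x hx
      have : x ∈ S := by simp only [S, mem_filter, mem_univ, true_and]; exact hx
      rw [hS] at this
      simp at this
    have eA : ∀ z : ℤ, efzTau k (-z - 1) = efzTau k (z + 1) := fun z => by
      rw [← efzTau_neg hk0]; congr 1; ring
    have eB : ∀ z : ℤ, efzTau k (-z + 1) = efzTau k (z - 1) := fun z => by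
      rw [← efzTau_neg hk0]; congr 1; ring
    apply efz_rev_ori
    refine efz_final hk (h.rev hk0) hcard (by rw [efzMu_rev]; exact ih) ?_ ?_ ?_ ?_
    · intro A; rw [efzB_rev, efzTau_neg hk0, efzDD_rev]; exact hsl A
    · intro v; rw [efzB_rev, Int.dvd_neg]; exact hz v
    · intro x; rw [efzB_rev, eA, efzDD_rev]; exact (hor x).resolve_left (h1 x)
    · intro x; rw [efzB_rev, eB, efzDD_rev]; exact h1 x

end

lemma efz_main_step.{u} {V : Type u} [Fintype V] [DecidableEq V] {k : ℤ}
    {w : V → V → ℤ} {a p q : V → ℤ} {X : Finset V} (hk : 2 ≤ k) (h : EfzInst k w a p q X)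
    (ih : EfzIH.{u} k (efzMu k w p q)) : EfzOri k w a := by
  have hk0 : 0 < k := by omega
  by_cases hcard : 2 ≤ Fintype.card V
  swap
  · have hsub : Subsingleton V := Fintype.card_le_one_iff_subsingleton.mp (by omega)
    refine ⟨fun _ _ => 0, by simp, fun x y => ?_, fun v => ?_⟩
    · rw [Subsingleton.elim x y, h.wd]; rfl
    · have h1 := h.sum
      rw [Finset.sum_eq_single v (fun y _ hy => absurd (Subsingleton.elim y v) hy) (by simp)] at h1
      simpa using h1
  by_cases h1 : ∃ A : Finset V, 2 ≤ A.card ∧ A ≠ univ ∧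
      efzDD w p q A ≤ 2 * k - 2 + efzTau k (efzB a p q A)
  · obtain ⟨A, a1, a2, a3⟩ := h1
    exact efz_step1 hk0 h ih A a1 a2 a3
  have hsl : ∀ A : Finset V, 2 ≤ A.card → A ≠ univ →
      2 * k + efzTau k (efzB a p q A) ≤ efzDD w p q A := by
    intro A a1 a2
    have hp := h.parity A
    have ht := efzTau_parity hk0 (efzB a p q A)
    rw [Int.even_iff] at hp
    have : ¬ efzDD w p q A ≤ 2 * k - 2 + efzTau k (efzB a p q A) := fun e => h1 ⟨A, a1, a2, e⟩
    omega
  by_cases hX : X = ∅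
  · subst hX
    by_cases hz : ∃ v, 2 * k ∣ efzB a p q {v}
    · obtain ⟨x, hx⟩ := hz
      have hI : EfzInst k w a p q {x} :=
        { h with
          X1 := by simp
          Xz := by
            intro y hy
            simp only [mem_singleton] at hy
            subst hy
            rwa [efzB_single] at hx
          cut := fun A a1 a2 _ => h.cut A a1 a2 (by simp) }
      exact efz_step2 hk0 hI hcard ih hsl
    · exact efz_step4 hk h hcard ih hsl (fun v e => hz ⟨v, e⟩)
  · obtain ⟨x, hx⟩ := nonempty_iff_ne_empty.mpr hX
    have : X = {x} := by
      ext y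
      rw [mem_singleton]
      exact ⟨fun hy => h.X1 y hy x hx, fun e => e ▸ hx⟩
    subst this
    exact efz_step2 hk0 h hcard ih hsl

lemma efz_main.{u} {k : ℤ} (hk : 2 ≤ k) : ∀ n : ℕ, EfzIH.{u} k n := by
  have mu0 : ∀ (V : Type u) [Fintype V] [DecidableEq V] (w : V → V → ℤ) (a p q : V → ℤ)
      (X : Finset V), EfzInst k w a p q X → 0 ≤ efzMu k w p q := by
    intro V _ _ w a p q X h
    unfold efzMu
    have h1 : 0 ≤ ∑ x, ∑ y, w x y := sum_nonneg fun _ _ => sum_nonneg fun _ _ => h.wn _ _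
    have h2 : 0 ≤ ∑ v, (p v + q v) := sum_nonneg fun v _ => add_nonneg (h.pn v) (h.qn v)
    have : 0 ≤ k * ∑ x, ∑ y, w x y := mul_nonneg (by omega) h1
    positivity
  intro n
  induction n with
  | zero =>
    intro V _ _ w a p q X h hlt
    have := mu0 V w a p q X h
    simp at hlt
    omega
  | succ n ihn =>
    intro V _ _ w a p q X h hlt
    apply efz_main_step hk h
    intro V' _ _ w' a' p' q' X' h' hlt'
    exact ihn V' w' a' p' q' X' h' (by push_cast at hlt; omega)

lemma efz_orient {V : Type*} [Fintype V] [DecidableEq V] {k : ℤ}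
    {w : V → V → ℤ} {a p q : V → ℤ} {X : Finset V} (hk : 2 ≤ k) (h : EfzInst k w a p q X) :
    EfzOri k w a := by
  refine efz_main hk ((efzMu k w p q).toNat + 1) V w a p q X h ?_
  push_cast
  omega


/-! Part C: application -/

lemma efz_realize {V E : Type*} [Fintype V] [DecidableEq V] (ends : E → V × V)
    (S : Finset E) : ∀ (f : V → V → ℤ), (∀ e ∈ S, (ends e).1 ≠ (ends e).2) →
      (∀ x y, 0 ≤ f x y) →
      (∀ x y, f x y + f y x = ∑ e ∈ S, efzD (ends e).1 (ends e).2 x y) →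
      ∃ t h : E → V, (∀ e, (t e = (ends e).1 ∧ h e = (ends e).2) ∨
        (t e = (ends e).2 ∧ h e = (ends e).1)) ∧
        ∀ x y, ∑ e ∈ S, efzC (t e) x * efzC (h e) y = f x y := by
  classical
  induction S using Finset.induction_on with
  | empty =>
    intro f _ f0 f1
    refine ⟨fun e => (ends e).1, fun e => (ends e).2, by simp, fun x y => ?_⟩
    have h1 := f1 x y
    have h2 := f0 x y
    have h3 := f0 y x
    simp at h1 ⊢
    omega
  | insert e S he ih =>
    intro f hl f0 f1
    have key : ∀ u v, u ≠ v → ((u = (ends e).1 ∧ v = (ends e).2) ∨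
        (u = (ends e).2 ∧ v = (ends e).1)) → 1 ≤ f u v →
        ∃ t h : E → V, (∀ e, (t e = (ends e).1 ∧ h e = (ends e).2) ∨
        (t e = (ends e).2 ∧ h e = (ends e).1)) ∧
        ∀ x y, ∑ e ∈ insert e S, efzC (t e) x * efzC (h e) y = f x y := by
      intro u v huv huv' hf
      obtain ⟨t, h, h1, h2⟩ := ih (fun x y => f x y - efzC u x * efzC v y)
        (fun e' he' => hl e' (mem_insert_of_mem he')) (by
          intro x y
          have := f0 x y
          unfold efzC
          split_ifs with a1 a2
          · subst a1; subst a2; simpa using hf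
          all_goals simpa using this) (by
          intro x y
          have h3 := f1 x y
          rw [sum_insert he] at h3
          have h4 : efzD (ends e).1 (ends e).2 x y =
              efzC u x * efzC v y + efzC u y * efzC v x := by
            unfold efzD
            rcases huv' with ⟨rfl, rfl⟩ | ⟨rfl, rfl⟩ <;> ring
          rw [h4] at h3
          linarith)
      refine ⟨Function.update t e u, Function.update h e v, ?_, ?_⟩
      · intro e'
        by_cases hee : e' = e
        · subst hee; simpa using huv'
        · simpa [hee] using h1 e'
      · intro x y
        rw [sum_insert he]
        have : ∑ e' ∈ S, efzC (Function.update t e u e') x * efzC (Function.update h e v e') y =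
            ∑ e' ∈ S, efzC (t e') x * efzC (h e') y := by
          apply sum_congr rfl
          intro e' he'
          have hee : e' ≠ e := by rintro rfl; exact he he'
          simp [hee]
        rw [this, h2]
        simp
    have hne := hl e (mem_insert_self _ _)
    have h1 := f1 (ends e).1 (ends e).2
    rw [sum_insert he] at h1
    have h2 : efzD (ends e).1 (ends e).2 (ends e).1 (ends e).2 = 1 := by
      simp [efzD, efzC, hne]
    have h3 : 0 ≤ ∑ e' ∈ S, efzD (ends e').1 (ends e').2 (ends e).1 (ends e).2 := by
      apply sum_nonneg
      intro e' _
      unfold efzD efzC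
      split_ifs <;> simp
    by_cases h4 : 1 ≤ f (ends e).1 (ends e).2
    · exact key _ _ hne (Or.inl ⟨rfl, rfl⟩) h4
    · exact key _ _ hne.symm (Or.inr ⟨rfl, rfl⟩) (by omega)

lemma efz_mdeg {V E : Type*} [DecidableEq V] (ends : E → V × V) (S : Finset E) (v : V) :
    (mdeg ends S v : ℤ) = ∑ e ∈ S, (efzC (ends e).1 v + efzC (ends e).2 v) := by
  unfold mdeg efzC
  push_cast [card_filter]
  rw [sum_add_distrib]
  simp only [eq_comm]

/-- the modulo orientation of an edge-connected multigraph -/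
lemma efz_modOri {V E : Type*} [Fintype V] [Fintype E] [DecidableEq V]
    (ends : E → V × V) (k : ℕ) (hk : 2 ≤ k) (hconn : EdgeConn ends (3 * k - 3))
    (P : V → ℤ) (hP : (k : ℤ) ∣ ∑ v, P v - Fintype.card E) :
    ∃ t h : E → V, (∀ e, (t e = (ends e).1 ∧ h e = (ends e).2) ∨
        (t e = (ends e).2 ∧ h e = (ends e).1)) ∧
      ∀ v, (k : ℤ) ∣ ∑ e, efzC (t e) v - P v := by
  classical
  let NL : Finset E := univ.filter (fun e => (ends e).1 ≠ (ends e).2)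
  have hNL : ∀ e ∈ NL, (ends e).1 ≠ (ends e).2 := by intro e he; simpa [NL] using he
  let w : V → V → ℤ := fun x y => ∑ e ∈ NL, efzD (ends e).1 (ends e).2 x y
  let deg : V → ℤ := fun v => ∑ e, (efzC (ends e).1 v + efzC (ends e).2 v)
  let a : V → ℤ := fun v => 2 * P v - deg v
  have hk' : (2 : ℤ) ≤ k := by exact_mod_cast hk
  have hk0 : (0 : ℤ) < k := by omega
  have wn : ∀ x y, 0 ≤ w x y := fun x y => sum_nonneg fun e _ => by
    unfold efzD efzC; split_ifs <;> simp
  have ws : ∀ x y, w x y = w y x := fun x y => sum_congr rfl fun e _ => efzD_symm _ _ _ _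
  have wd : ∀ x, w x x = 0 := fun x => sum_eq_zero fun e he => efzD_diag (hNL e he) x
  have hdeg : ∀ v, deg v = ∑ e ∈ NL, (efzC (ends e).1 v + efzC (ends e).2 v) +
      2 * ∑ e ∈ NLᶜ, efzC (ends e).1 v := by
    intro v
    change ∑ e, _ = _
    rw [← Finset.sum_add_sum_compl NL, mul_sum]
    congr 1
    apply sum_congr rfl
    intro e he
    simp only [NL, compl_filter, mem_filter, mem_univ, true_and, not_not] at he
    rw [he]; ring
  have hrow : ∀ v, ∑ y, w v y = ∑ e ∈ NL, (efzC (ends e).1 v + efzC (ends e).2 v) := by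
    intro v
    change ∑ y, ∑ e ∈ NL, _ = _
    rw [sum_comm]
    exact sum_congr rfl fun e _ => efzD_row _ _ _
  have par : ∀ v, Even (∑ y, w v y + a v) := by
    intro v
    refine ⟨P v - ∑ e ∈ NLᶜ, efzC (ends e).1 v, ?_⟩
    rw [hrow]
    change _ + (2 * P v - deg v) = _
    rw [hdeg]; ring
  have hcut : ∀ A, efzCut w A = cutCard ends A := by
    intro A
    have e1 : efzCut w A = ∑ e ∈ NL, efzCut (efzD (ends e).1 (ends e).2) A := by
      unfold efzCut
      simp only [w]
      rw [sum_comm]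
      rw [sum_congr rfl (fun y _ => sum_comm), sum_comm]
      apply sum_congr rfl
      intro e _
      rw [sum_comm]
    rw [e1]
    unfold cutCard
    rw [card_filter]
    push_cast
    rw [← Finset.sum_add_sum_compl NL]
    have e2 : ∑ e ∈ NLᶜ, (if ((ends e).1 ∈ A ∧ (ends e).2 ∉ A) ∨
        ((ends e).1 ∉ A ∧ (ends e).2 ∈ A) then (1 : ℤ) else 0) = 0 := by
      apply sum_eq_zero
      intro e he
      simp only [NL, compl_filter, mem_filter, mem_univ, true_and, not_not] at he
      rw [he]
      simp
    rw [e2, add_zero]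
    apply sum_congr rfl
    intro e _
    rw [efzD_cut]
    by_cases h1 : (ends e).1 ∈ A <;> by_cases h2 : (ends e).2 ∈ A <;> simp [efzI, h1, h2]
  have hI : EfzInst (k : ℤ) w a (fun _ => 0) (fun _ => 0) ∅ := by
    constructor
    · exact wn
    · exact ws
    · exact wd
    · simp
    · simp
    · exact par
    · have : ∑ v, deg v = 2 * Fintype.card E := by
        simp only [deg]
        rw [sum_comm]
        simp only [sum_add_distrib, efzC_sum_univ]
        simp; ring
      obtain ⟨c, hc⟩ := hP
      refine ⟨c, ?_⟩
      simp only [a]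
      rw [sum_sub_distrib, this, ← mul_sum]
      linarith
    · simp
    · simp
    · intro A h1 h2 _
      have hp := efz_parity (fun _ => 0) (fun _ => 0) ws wd par A
      have hc := hconn A h1 h2
      have ht := efzTau_parity hk0 (efzB a (fun _ => 0) (fun _ => 0) A)
      have htk := efzTau_le_k (k := k) (efzB a (fun _ => 0) (fun _ => 0) A)
      have hd : efzDD w (fun _ => 0) (fun _ => 0) A = cutCard ends A := by
        rw [← hcut]; simp [efzDD]
      rw [hd] at hp ⊢
      rw [Int.even_iff] at hp
      have hc' : 3 * (k : ℤ) - 3 ≤ cutCard ends A := by omega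
      omega
    · have := efzTau_nonneg hk0 (efzB a (fun _ => 0) (fun _ => 0) univ)
      simp only [add_zero, sum_const_zero]
      omega
  obtain ⟨f, f0, f1, f2⟩ := efz_orient hk' hI
  obtain ⟨t, h, h1, h2⟩ := efz_realize ends NL f hNL f0 f1
  refine ⟨t, h, h1, fun v => ?_⟩
  have o1 : ∑ y, f v y = ∑ e ∈ NL, efzC (t e) v := by
    rw [sum_congr rfl (fun y _ => (h2 v y).symm), sum_comm]
    apply sum_congr rfl
    intro e _
    rw [← mul_sum, efzC_sum_univ, mul_one]
  have o2 : ∑ y, f y v = ∑ e ∈ NL, efzC (h e) v := by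
    rw [sum_congr rfl (fun y _ => (h2 y v).symm), sum_comm]
    apply sum_congr rfl
    intro e _
    rw [← sum_mul, efzC_sum_univ, one_mul]
  have o3 : ∑ e ∈ NL, (efzC (ends e).1 v + efzC (ends e).2 v) =
      ∑ e ∈ NL, efzC (t e) v + ∑ e ∈ NL, efzC (h e) v := by
    rw [← sum_add_distrib]
    apply sum_congr rfl
    intro e _
    rcases h1 e with ⟨e1, e2⟩ | ⟨e1, e2⟩ <;> rw [e1, e2]
    ring
  have o4 : ∑ e ∈ NLᶜ, efzC (t e) v = ∑ e ∈ NLᶜ, efzC (ends e).1 v := by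
    apply sum_congr rfl
    intro e he
    simp only [NL, compl_filter, mem_filter, mem_univ, true_and, not_not] at he
    rcases h1 e with ⟨e1, e2⟩ | ⟨e1, e2⟩ <;> rw [e1]
    rw [he]
  have o5 := Finset.sum_add_sum_compl NL (fun e => efzC (t e) v)
  obtain ⟨c, hc⟩ := f2 v
  rw [sum_sub_distrib, o1, o2] at hc
  change _ - (2 * P v - deg v) = _ at hc
  rw [hdeg, o3] at hc
  refine ⟨c, ?_⟩
  rw [← o5, o4]
  linarith

lemma efz_avg {k : ℕ} (hk : 0 < k) (F : Fin k → ℤ) (hF : ∀ i j, F i ≤ F j + 1) (i : Fin k) :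
    |(k : ℤ) * F i - ∑ j, F j| < k := by
  have e : (k : ℤ) * F i - ∑ j, F j = ∑ j, (F i - F j) := by
    rw [sum_sub_distrib]; simp
  have up : ∑ j, (F i - F j) < ∑ _j : Fin k, (1 : ℤ) :=
    sum_lt_sum (fun j _ => by linarith [hF i j]) ⟨i, mem_univ i, by simp⟩
  have lo : ∑ _j : Fin k, (-1 : ℤ) < ∑ j, (F i - F j) :=
    sum_lt_sum (fun j _ => by linarith [hF j i]) ⟨i, mem_univ i, by simp⟩
  simp only [sum_const, card_univ, Fintype.card_fin, nsmul_eq_mul, mul_one, mul_neg] at up lo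
  rw [e, abs_lt]
  exact ⟨lo, up⟩

lemma efz_avg_dvd {k : ℕ} (hk : 0 < k) (F : Fin k → ℤ) (hF : ∀ i j, F i ≤ F j + 1) (i : Fin k)
    (hd : (k : ℤ) ∣ ∑ j, F j) : (k : ℤ) * F i - ∑ j, F j = 0 := by
  have h1 := efz_avg hk F hF i
  exact Int.eq_zero_of_abs_lt_dvd ((dvd_mul_right _ _).sub hd) h1

lemma efzCnt_sum {V E : Type*} [Fintype E] [DecidableEq V] {k : ℕ} (t : E → V) (c : E → Fin k)
    (v : V) : ∑ i, efzCnt t c v i = ∑ e, efzC (t e) v := by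
  unfold efzCnt efzC
  rw [sum_comm]
  apply sum_congr rfl
  intro e _
  by_cases h : t e = v
  · simp [h]
  · simp [h, Ne.symm h]

/-- Equitable factorization of `(3k−3)`-edge-connected multigraphs, provided there is a
vertex set `Z` with `|E(G)| ≡ ∑_{v ∈ Z} d_G(v) (mod k)`. -/
theorem equitable_factorization_Z [Fintype V] [Fintype E] [DecidableEq V]
    (ends : E → V × V) (k : ℕ) (hk : 0 < k)
    (hconn : EdgeConn ends (3 * k - 3))
    (hZ : ∃ Z : Finset V, Fintype.card E ≡ ∑ v ∈ Z, mdeg ends univ v [MOD k]) :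
    ∃ c : E → Fin k, ∀ v : V, ∀ i : Fin k,
      |((mdeg ends (univ.filter fun e => c e = i) v : ℝ)) -
        (mdeg ends univ v : ℝ) / (k : ℝ)| < 1 := by
  classical
  by_cases hk1 : k = 1
  · subst hk1
    refine ⟨fun _ => 0, fun v i => ?_⟩
    have : (univ.filter fun e : E => (0 : Fin 1) = i) = univ := by
      ext e; simp [Subsingleton.elim (0 : Fin 1) i]
    rw [this]
    simp
  have hk2 : 2 ≤ k := by omega
  obtain ⟨Z, hZ⟩ := hZ
  let P : V → ℤ := fun v => if v ∈ Z then (mdeg ends univ v : ℤ) else 0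
  have hP : (k : ℤ) ∣ ∑ v, P v - Fintype.card E := by
    have h1 := (Nat.modEq_iff_dvd.mp hZ)
    have h2 : ∑ v, P v = ((∑ v ∈ Z, mdeg ends univ v : ℕ) : ℤ) := by
      simp only [P]
      push_cast
      rw [← sum_filter]
      simp
    rw [h2]; exact h1
  obtain ⟨t, h, hth, hmod⟩ := efz_modOri ends k hk2 hconn P hP
  obtain ⟨c, c1, c2⟩ := efz_equitable hk t h
  refine ⟨c, fun v i => ?_⟩
  have hsplit : ∀ e, efzC (ends e).1 v + efzC (ends e).2 v = efzC (t e) v + efzC (h e) v := by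
    intro e
    rcases hth e with ⟨e1, e2⟩ | ⟨e1, e2⟩ <;> rw [e1, e2]
    ring
  have hd : (mdeg ends univ v : ℤ) = ∑ j, efzCnt t c v j + ∑ j, efzCnt h c v j := by
    rw [efz_mdeg, sum_congr rfl (fun e _ => hsplit e), sum_add_distrib, efzCnt_sum, efzCnt_sum]
  have hm : (mdeg ends (univ.filter fun e => c e = i) v : ℤ) =
      efzCnt t c v i + efzCnt h c v i := by
    rw [efz_mdeg, sum_congr rfl (fun e _ => hsplit e), sum_filter]
    unfold efzCnt efzC
    rw [← sum_add_distrib]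
    apply sum_congr rfl
    intro e _
    by_cases q1 : c e = i <;> by_cases q2 : t e = v <;> by_cases q3 : h e = v <;>
      simp [q1, q2, q3, eq_comm (a := v)]
  have hmain : |(k : ℤ) * (mdeg ends (univ.filter fun e => c e = i) v : ℤ) -
      (mdeg ends univ v : ℤ)| < k := by
    have a1 := efz_avg hk (efzCnt t c v) (c1 v) i
    have a2 := efz_avg hk (efzCnt h c v) (c2 v) i
    have hmv := hmod v
    rw [← efzCnt_sum t c v] at hmv
    by_cases hv : v ∈ Z
    · have hPv : P v = mdeg ends univ v := by simp [P, hv]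
      rw [hPv, hd] at hmv
      have hdv : (k : ℤ) ∣ ∑ j, efzCnt h c v j := by
        obtain ⟨r, hr⟩ := hmv
        exact ⟨-r, by linarith⟩
      have a3 := efz_avg_dvd hk (efzCnt h c v) (c2 v) i hdv
      rw [hm, hd]
      rwa [show (k : ℤ) * (efzCnt t c v i + efzCnt h c v i) -
        (∑ j, efzCnt t c v j + ∑ j, efzCnt h c v j) =
        (k : ℤ) * efzCnt t c v i - ∑ j, efzCnt t c v j by linarith]
    · have hPv : P v = 0 := by simp [P, hv]
      rw [hPv, sub_zero] at hmv
      have a3 := efz_avg_dvd hk (efzCnt t c v) (c1 v) i hmv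
      rw [hm, hd]
      rwa [show (k : ℤ) * (efzCnt t c v i + efzCnt h c v i) -
        (∑ j, efzCnt t c v j + ∑ j, efzCnt h c v j) =
        (k : ℤ) * efzCnt h c v i - ∑ j, efzCnt h c v j by linarith]
  have hkR : (0 : ℝ) < k := by exact_mod_cast hk
  have hR : |(k : ℝ) * (mdeg ends (univ.filter fun e => c e = i) v : ℝ) -
      (mdeg ends univ v : ℝ)| < k := by exact_mod_cast hmain
  have e : ((mdeg ends (univ.filter fun e => c e = i) v : ℝ)) -
        (mdeg ends univ v : ℝ) / (k : ℝ) = ((k : ℝ) *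
        (mdeg ends (univ.filter fun e => c e = i) v : ℝ) - (mdeg ends univ v : ℝ)) / k := by
    field_simp
  rw [e, abs_div, abs_of_pos hkR, div_lt_one hkR]
  exact hR
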